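/- arXiv:1811.06761 — 5 statements merged into one kernel-verified Lean document; each statement's English description precedes it below -/
import Mathlib

section
/- Every graph that has no K4-minor and contains the complete bipartite graph K(2,3) as a minor has a b-rich separator. -/
open SimpleGraph

/-- `H` is a minor of `G` (branch-set definition): there is a family of connected, nonempty,
pairwise disjoint branch sets in `G`, indexed by the vertices of `H`, such that vertices
adjacent in `H` have an edge of `G` between their branch sets. -/
def IsMinorOf {W V : Type} (H : SimpleGraph W) (G : SimpleGraph V) : Prop :=
  ∃ f : W → Set V,
    (∀ w, (G.induce (f w)).Connected) ∧
    (∀ ⦃w w' : W⦄, w ≠ w' → Disjoint (f w) (f w')) ∧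
    (∀ ⦃w w' : W⦄, H.Adj w w' → ∃ a ∈ f w, ∃ b ∈ f w', G.Adj a b)

/-- `G` is `k`-connected: between any two distinct vertices `u ≠ v` there exist `k`
pairwise distinct `(u,v)`-paths, any two of which share no vertices other than `u,v`. -/
def KConnected {V : Type} (k : ℕ) (G : SimpleGraph V) : Prop :=
  ∀ ⦃u v : V⦄, u ≠ v → ∃ P : Fin k → G.Walk u v,
    Function.Injective P ∧ (∀ i, (P i).IsPath) ∧
      ∀ i j, i ≠ j → ∀ x, x ∈ (P i).support → x ∈ (P j).support → x = u ∨ x = v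

/-- A separator: a vertex set whose deletion increases the number of connected components. -/
def IsSeparator {V : Type} (G : SimpleGraph V) (S : Set V) : Prop :=
  Nat.card G.ConnectedComponent < Nat.card (G.induce Sᶜ).ConnectedComponent

/-- The augmented connected component of `G` corresponding to a connected component `C`
of `G - S`: the induced subgraph on `V(C) ∪ S` together with all edges inside `S`. -/
def augComp {V : Type} (G : SimpleGraph V) (S : Set V)
    (C : (G.induce Sᶜ).ConnectedComponent) :
    SimpleGraph ↥(Subtype.val '' C.supp ∪ S) :=
  SimpleGraph.fromRel fun a b => G.Adj (a : V) (b : V) ∨ ((a : V) ∈ S ∧ (b : V) ∈ S)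

/-- A block of `G`: a maximal biconnected subgraph. -/
def IsBlock {V : Type} (G : SimpleGraph V) (B : G.Subgraph) : Prop :=
  KConnected 2 B.coe ∧ ∀ B' : G.Subgraph, B ≤ B' → KConnected 2 B'.coe → B' = B

/-- The augmented connected component of `G - S` corresponding to `C` contains an `S`-block,
i.e. a block containing all of `S`. -/
def HasSBlock {V : Type} (G : SimpleGraph V) (S : Set V)
    (C : (G.induce Sᶜ).ConnectedComponent) : Prop :=
  ∃ B : (augComp G S C).Subgraph, IsBlock (augComp G S C) B ∧
    ∀ (s : V) (hs : s ∈ S),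
      (⟨s, Set.mem_union_right _ hs⟩ : ↥(Subtype.val '' C.supp ∪ S)) ∈ B.verts

/-- A b-rich separator: a 2-separator `S` such that at least three augmented connected
components of `G - S` contain `S`-blocks. -/
def BRichSeparator {V : Type} (G : SimpleGraph V) (S : Set V) : Prop :=
  IsSeparator G S ∧ S.ncard = 2 ∧
    ∃ C₁ C₂ C₃ : (G.induce Sᶜ).ConnectedComponent,
      C₁ ≠ C₂ ∧ C₁ ≠ C₃ ∧ C₂ ≠ C₃ ∧
        HasSBlock G S C₁ ∧ HasSBlock G S C₂ ∧ HasSBlock G S C₃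

/-- A graph with a Hamiltonian closed cycle is biconnected. -/
theorem kConnected_two_of_isCycle {W : Type} {K : SimpleGraph W} {w : W} {c : K.Walk w w}
    (hc : c.IsCycle) (hs : ∀ x, x ∈ c.support) : KConnected 2 K := by
  classical
  intro u v huv
  have hc' : (c.rotate u (hs u)).IsCycle := hc.rotate (hs u)
  have hv : v ∈ (c.rotate u (hs u)).support := (c.mem_support_rotate_iff u (hs u)).2 (hs v)
  set d := c.rotate u (hs u)
  set p := d.takeUntil v hv
  set q := d.dropUntil v hv
  have hpq : p.append q = d := d.take_spec hv
  have hpn : ¬ p.Nil := Walk.not_nil_of_ne huv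
  have hqn : ¬ q.Nil := Walk.not_nil_of_ne huv.symm
  have hp : p.IsPath := Walk.IsCycle.isPath_of_append_left hqn (hpq ▸ hc')
  have hq : q.IsPath := Walk.IsCycle.isPath_of_append_right hpn (hpq ▸ hc')
  have hcommon : ∀ x, x ∈ p.support → x ∈ q.support → x = u ∨ x = v := by
    intro x hxp hxq
    have hnd := (hpq ▸ hc').support_nodup
    rw [Walk.tail_support_append, List.nodup_append'] at hnd
    rw [← Walk.cons_tail_support, List.mem_cons] at hxp hxq
    rcases hxp with rfl | hxp
    · exact Or.inl rfl
    rcases hxq with rfl | hxq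
    · exact Or.inr rfl
    exact (hnd.2.2 hxp hxq).elim
  have hne : p ≠ q.reverse := by
    intro h
    have hnd := (hpq ▸ hc').edges_nodup
    rw [Walk.edges_append, List.nodup_append'] at hnd
    obtain ⟨e, he⟩ := List.exists_mem_of_ne_nil p.edges (by simpa using hpn)
    refine hnd.2.2 he ?_
    rw [h] at he
    simpa using he
  refine ⟨![p, q.reverse], ?_, ?_, ?_⟩
  · intro i j
    fin_cases i <;> fin_cases j <;> simp [hne, hne.symm]
  · intro i
    fin_cases i <;> simp [hp, hq]
  · intro i j hij x
    fin_cases i <;> fin_cases j <;> simp at hij ⊢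
    · exact hcommon x
    · exact fun h₁ h₂ => hcommon x h₂ h₁

/-- Every cycle lies in a block. -/
theorem exists_isBlock_of_isCycle {W : Type} [Finite W] {H : SimpleGraph W} {w : W}
    {c : H.Walk w w} (hc : c.IsCycle) :
    ∃ B : H.Subgraph, IsBlock H B ∧ ∀ x ∈ c.support, x ∈ B.verts := by
  have hmap := c.map_mapToSubgraph_hom
  have hcyc : KConnected 2 c.toSubgraph.coe := by
    refine kConnected_two_of_isCycle (c := c.mapToSubgraph)
      (Walk.IsCycle.of_map (f := c.toSubgraph.hom) (hmap.symm ▸ hc)) ?_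
    rintro ⟨x, hx⟩
    have hx' : x ∈ (c.mapToSubgraph.map c.toSubgraph.hom).support := by
      rw [hmap]; exact c.mem_verts_toSubgraph.1 hx
    rw [Walk.support_map, List.mem_map] at hx'
    obtain ⟨y, hy, hyx⟩ := hx'
    exact (Subtype.ext hyx : y = ⟨x, hx⟩) ▸ hy
  obtain ⟨B, hle, hB⟩ :=
    Finite.exists_le_maximal (p := fun B : H.Subgraph => KConnected 2 B.coe) hcyc
  exact ⟨B, ⟨hB.prop, fun B' hBB' hB' => le_antisymm (hB.le_of_ge hB' hBB') hBB'⟩,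
    fun x hx => hle.1 (c.mem_verts_toSubgraph.2 hx)⟩

/-- A component of `G - {s, t}` with neighbours of both `s` and `t` contains an `{s, t}`-block. -/
theorem hasSBlock_of_adj {V : Type} [Finite V] {G : SimpleGraph V} {s t : V} (hst : s ≠ t)
    {C : (G.induce ({s, t} : Set V)ᶜ).ConnectedComponent} {x y : ↥(({s, t} : Set V)ᶜ)}
    (hx : x ∈ C.supp) (hy : y ∈ C.supp) (hsx : G.Adj s x) (hty : G.Adj t y) :
    HasSBlock G {s, t} C := by
  classical
  let H := augComp G {s, t} C
  let f : C.toSimpleGraph →g H :=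
    { toFun := fun z => ⟨z.1.1, Or.inl ⟨z.1, z.2, rfl⟩⟩
      map_rel' := by
        intro a b hab
        have hab' : G.Adj a.1.1 b.1.1 := hab
        simp only [H, augComp, fromRel_adj]
        exact ⟨fun h => hab'.ne (Subtype.mk.inj h), Or.inl (Or.inl hab')⟩ }
  have hf : Function.Injective f := fun a b h =>
    Subtype.ext (Subtype.ext (Subtype.mk.inj h))
  have hfS : ∀ z, (f z).1 ≠ s ∧ (f z).1 ≠ t := fun z => by
    have := z.1.2
    simp only [Set.mem_compl_iff, Set.mem_insert_iff, Set.mem_singleton_iff, not_or] at this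
    exact this
  let s' : ↥(Subtype.val '' C.supp ∪ {s, t}) := ⟨s, Or.inr (by simp)⟩
  let t' : ↥(Subtype.val '' C.supp ∪ {s, t}) := ⟨t, Or.inr (by simp)⟩
  obtain ⟨p, hp⟩ := C.connected_toSimpleGraph.exists_isPath ⟨x, hx⟩ ⟨y, hy⟩
  let q := p.map f
  have hq : q.IsPath := Walk.IsPath.map hf hp
  have hqS : ∀ z ∈ q.support, z.1 ≠ s ∧ z.1 ≠ t := by
    intro z hz
    simp only [q, Walk.support_map, List.mem_map] at hz
    obtain ⟨a, -, rfl⟩ := hz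
    exact hfS a
  have hsx' : H.Adj s' (f ⟨x, hx⟩) := by
    simp only [H, augComp, fromRel_adj]
    exact ⟨fun h => hsx.ne (congrArg Subtype.val h), Or.inl (Or.inl hsx)⟩
  have hyt' : H.Adj (f ⟨y, hy⟩) t' := by
    simp only [H, augComp, fromRel_adj]
    exact ⟨fun h => hty.ne (congrArg Subtype.val h).symm, Or.inl (Or.inl hty.symm)⟩
  have hts' : H.Adj t' s' := by
    simp only [H, augComp, fromRel_adj]
    exact ⟨fun h => hst (congrArg Subtype.val h).symm, Or.inl (Or.inr ⟨by simp [t'], by simp [s']⟩)⟩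
  have hs'q : s' ∉ q.support := fun h => (hqS _ h).1 rfl
  have ht'q : t' ∉ q.support := fun h => (hqS _ h).2 rfl
  have hr : (Walk.cons hsx' (q.concat hyt')).IsPath := by
    rw [Walk.cons_isPath_iff]
    refine ⟨hq.concat ht'q hyt', ?_⟩
    simp only [Walk.support_concat, List.mem_append, List.mem_singleton, not_or]
    exact ⟨hs'q, hts'.ne'⟩
  have hcyc : (Walk.cons hts' (Walk.cons hsx' (q.concat hyt'))).IsCycle := by
    rw [Walk.cons_isCycle_iff]
    refine ⟨hr, ?_⟩
    simp only [Walk.edges_cons, Walk.edges_concat, List.concat_eq_append, List.mem_append, List.mem_cons,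
      not_or, List.not_mem_nil, or_false]
    refine ⟨?_, ?_, ?_⟩
    · intro h
      have : t' ∈ s(s', f ⟨x, hx⟩) := h ▸ Sym2.mem_mk_left _ _
      rcases Sym2.mem_iff.1 this with h | h
      · exact hts'.ne h
      · exact (hfS ⟨x, hx⟩).2 (congrArg Subtype.val h).symm
    · exact fun h => ht'q (q.fst_mem_support_of_mem_edges h)
    · intro h
      have : s' ∈ s(f ⟨y, hy⟩, t') := h ▸ Sym2.mem_mk_right _ _
      rcases Sym2.mem_iff.1 this with h | h
      · exact (hfS ⟨y, hy⟩).1 (congrArg Subtype.val h).symm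
      · exact hts'.ne h.symm
  obtain ⟨B, hB, hcB⟩ := exists_isBlock_of_isCycle hcyc
  refine ⟨B, hB, ?_⟩
  rintro z (rfl | rfl)
  · exact hcB s' (by simp)
  · exact hcB t' (by simp)

/-- A finite nontrivial connected graph has two vertices whose removal, one at a time, leaves
the graph connected. -/
theorem SimpleGraph.Connected.exists_ne_connected_induce_compl_singleton {W : Type} [Finite W]
    [Nontrivial W] {K : SimpleGraph W} (hK : K.Connected) :
    ∃ u v : W, u ≠ v ∧ (K.induce {u}ᶜ).Connected ∧ (K.induce {v}ᶜ).Connected := by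
  obtain ⟨T, hle, hT⟩ := hK.exists_isTree_le
  have := Fintype.ofFinite W
  classical
  obtain ⟨u, v, huv, hu, hv⟩ := hT.exists_ne_and_degree_eq_one
  exact ⟨u, v, huv, (hT.connected.induce_compl_singleton_of_degree_eq_one hu).mono (by tauto),
    (hT.connected.induce_compl_singleton_of_degree_eq_one hv).mono (by tauto)⟩

/-- A version of `SimpleGraph.Connected.exists_ne_connected_induce_compl_singleton` for vertex
sets inducing connected subgraphs. -/
theorem exists_ne_connected_induce_diff_singleton {V : Type} [Finite V] {G : SimpleGraph V}
    {A : Set V} (hA : (G.induce A).Connected) (hnt : A.Nontrivial) :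
    ∃ u ∈ A, ∃ v ∈ A, u ≠ v ∧ (G.induce (A \ {u})).Connected ∧
      (G.induce (A \ {v})).Connected := by
  have : Nontrivial A := Set.nontrivial_coe_sort.2 hnt
  obtain ⟨u, v, huv, hu, hv⟩ := hA.exists_ne_connected_induce_compl_singleton
  have key : ∀ w : A, ((G.induce A).induce {w}ᶜ).Connected →
      (G.induce (A \ {w.1})).Connected := by
    intro w hw
    let f : (G.induce A).induce {w}ᶜ →g G.induce (A \ {w.1}) :=
      { toFun := fun z => ⟨z.1.1, z.1.2, fun h => z.2 (Subtype.ext h)⟩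
        map_rel' := fun h => h }
    refine hw.map f ?_
    rintro ⟨z, hz, hzw⟩
    exact ⟨⟨⟨z, hz⟩, fun h => hzw (congrArg Subtype.val h)⟩, rfl⟩
  exact ⟨u, u.2, v, v.2, fun h => huv (Subtype.ext h), key u hu, key v hv⟩

/-- Adding a neighbour to a connected vertex set keeps it connected. -/
theorem connected_induce_insert {V : Type} {G : SimpleGraph V} {A : Set V} {v a : V}
    (hA : (G.induce A).Connected) (ha : a ∈ A) (hva : G.Adj v a) :
    (G.induce (insert v A)).Connected :=
  connected_induce_union (s := {v}) Preconnected.of_subsingleton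
    hA.preconnected rfl ha hva

/-- If a connected set `A` has edges to three disjoint connected sets, then some `a ∈ A` is
adjacent to all three after enlarging them inside `A \ {a}`. -/
theorem exists_adj_of_three_connected {V : Type} [Finite V] {G : SimpleGraph V} (A : Set V)
    (C : Fin 3 → Set V) (hA : (G.induce A).Connected) (hC : ∀ i, (G.induce (C i)).Connected)
    (hdisj : ∀ i j, i ≠ j → Disjoint (C i) (C j)) (hAC : ∀ i, Disjoint A (C i))
    (hadj : ∀ i, ∃ a ∈ A, ∃ c ∈ C i, G.Adj a c) :
    ∃ a ∈ A, ∃ D : Fin 3 → Set V, (∀ i, C i ⊆ D i) ∧ (∀ i, D i ⊆ C i ∪ A \ {a}) ∧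
      (∀ i, (G.induce (D i)).Connected) ∧ (∀ i j, i ≠ j → Disjoint (D i) (D j)) ∧
      ∀ i, ∃ c ∈ D i, G.Adj a c := by
  classical
  induction hn : A.ncard using Nat.strong_induction_on generalizing A C with
  | _ n ih =>
  rcases A.subsingleton_or_nontrivial with hs | hnt
  · obtain ⟨⟨a, ha⟩⟩ := hA.nonempty
    refine ⟨a, ha, C, fun i => subset_rfl, fun i => Set.subset_union_left, hC, hdisj, fun i => ?_⟩
    obtain ⟨b, hb, c, hc, hbc⟩ := hadj i
    exact ⟨c, hc, hs hb ha ▸ hbc⟩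
  let U : V → Fin 3 → Prop := fun v i => ∀ a ∈ A, ∀ c ∈ C i, G.Adj a c → a = v
  have hUne : ∀ u v i, u ≠ v → U u i → ¬ U v i := by
    intro u v i huv hu hv
    obtain ⟨a, ha, c, hc, hac⟩ := hadj i
    exact huv ((hu a ha c hc hac).symm.trans (hv a ha c hc hac))
  obtain ⟨v, hvA, hv, hU⟩ : ∃ v ∈ A, (G.induce (A \ {v})).Connected ∧
      ∀ i j, U v i → U v j → i = j := by
    obtain ⟨u, huA, v, hvA, huv, hu, hv⟩ := exists_ne_connected_induce_diff_singleton hA hnt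
    by_cases h₁ : ∀ i j, U u i → U u j → i = j
    · exact ⟨u, huA, hu, h₁⟩
    by_cases h₂ : ∀ i j, U v i → U v j → i = j
    · exact ⟨v, hvA, hv, h₂⟩
    exfalso
    push Not at h₁ h₂
    obtain ⟨i, j, hi, hj, hij⟩ := h₁
    obtain ⟨k, l, hk, hl, hkl⟩ := h₂
    have hik : i ≠ k := fun h => hUne u v i huv hi (h ▸ hk)
    have hil : i ≠ l := fun h => hUne u v i huv hi (h ▸ hl)
    have hjk : j ≠ k := fun h => hUne u v j huv hj (h ▸ hk)
    have hjl : j ≠ l := fun h => hUne u v j huv hj (h ▸ hl)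
    omega
  have hvC : ∀ i, v ∉ C i := fun i => Set.disjoint_left.1 (hAC i) hvA
  let C₁ : Fin 3 → Set V := fun i => if U v i then insert v (C i) else C i
  have hCC₁ : ∀ i, C i ⊆ C₁ i := by
    intro i
    by_cases h : U v i <;> simp [C₁, h]
  have hC₁ : ∀ i z, z ∈ C₁ i ↔ z ∈ C i ∨ (z = v ∧ U v i) := by
    intro i z
    by_cases h : U v i <;> simp [C₁, h, or_comm]
  obtain ⟨a, ha, D, hCD, hDC, hD, hDd, haD⟩ := ih (A \ {v}).ncard
    (hn ▸ Set.ncard_sdiff_singleton_lt_of_mem hvA) (A \ {v}) C₁ hv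
    (by
      intro i
      by_cases h : U v i
      · obtain ⟨b, hb, c, hc, hbc⟩ := hadj i
        have hbv := h b hb c hc hbc
        rw [show C₁ i = insert v (C i) from if_pos h]
        exact connected_induce_insert (hC i) hc (hbv ▸ hbc)
      · rw [show C₁ i = C i from if_neg h]
        exact hC i)
    (by
      intro i j hij
      rw [Set.disjoint_left]
      intro z hzi hzj
      rw [hC₁] at hzi hzj
      rcases hzi with hzi | ⟨rfl, hi⟩ <;> rcases hzj with hzj | ⟨hz, hj⟩
      · exact Set.disjoint_left.1 (hdisj i j hij) hzi hzj
      · exact hvC i (hz ▸ hzi)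
      · exact hvC j hzj
      · exact hij (hU i j hi hj))
    (by
      intro i
      rw [Set.disjoint_left]
      rintro z ⟨hzA, hzv⟩ hz
      rcases (hC₁ i z).1 hz with hz | ⟨hz, -⟩
      · exact Set.disjoint_left.1 (hAC i) hzA hz
      · exact hzv hz)
    (by
      intro i
      by_cases h : U v i
      · have : Nontrivial A := Set.nontrivial_coe_sort.2 hnt
        obtain ⟨b, hb⟩ := hA.preconnected.exists_adj_of_nontrivial ⟨v, hvA⟩
        have hvb : G.Adj v b.1 := hb
        exact ⟨b, ⟨b.2, hvb.ne'⟩, v, (hC₁ i v).2 (Or.inr ⟨rfl, h⟩), hvb.symm⟩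
      · simp only [U, not_forall] at h
        obtain ⟨b, hb, c, hc, hbc, hbv⟩ := h
        exact ⟨b, ⟨hb, hbv⟩, c, hCC₁ i hc, hbc⟩)
    rfl
  refine ⟨a, ha.1, D, fun i => (hCC₁ i).trans (hCD i), ?_, hD, hDd, haD⟩
  intro i z hz
  rcases hDC i hz with hz | hz
  · rcases (hC₁ i z).1 hz with hz | ⟨rfl, -⟩
    · exact Or.inl hz
    · exact Or.inr ⟨hvA, fun h => ha.2 h.symm⟩
  · exact Or.inr ⟨hz.1.1, hz.2⟩

/-- Four pairwise disjoint, pairwise adjacent connected sets form a `K₄`-minor. -/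
theorem isMinorOf_completeGraph_four {V : Type} {G : SimpleGraph V} (f : Fin 4 → Set V)
    (hf : ∀ i, (G.induce (f i)).Connected) (hd : ∀ i j, i < j → Disjoint (f i) (f j))
    (ha : ∀ i j, i < j → ∃ a ∈ f i, ∃ b ∈ f j, G.Adj a b) :
    IsMinorOf (completeGraph (Fin 4)) G := by
  refine ⟨f, hf, fun i j hij => ?_, fun i j hij => ?_⟩
  · rcases lt_or_gt_of_ne hij with h | h
    · exact hd i j h
    · exact (hd j i h).symm
  · rcases lt_or_gt_of_ne hij.ne with h | h
    · exact ha i j h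
    · obtain ⟨a, haj, b, hbi, hab⟩ := ha j i h
      exact ⟨b, hbi, a, haj, hab.symm⟩

/-- In a `K₄`-minor-free graph, two of three disjoint connected sets that are all adjacent to
both `s` and `t` have no edge between them. -/
theorem not_adj_of_K4free {V : Type} {G : SimpleGraph V}
    (h4 : ¬ IsMinorOf (completeGraph (Fin 4)) G) {s t : V} (hst : s ≠ t) {D : Fin 3 → Set V}
    (hD : ∀ i, (G.induce (D i)).Connected) (hd : ∀ i j, i ≠ j → Disjoint (D i) (D j))
    (hsD : ∀ i, s ∉ D i) (htD : ∀ i, t ∉ D i) (hs : ∀ i, ∃ c ∈ D i, G.Adj s c)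
    (ht : ∀ i, ∃ c ∈ D i, G.Adj t c) {i j : Fin 3} (hij : i ≠ j) {x y : V} (hx : x ∈ D i)
    (hy : y ∈ D j) : ¬ G.Adj x y := by
  intro hxy
  obtain ⟨k, hki, hkj⟩ : ∃ k : Fin 3, k ≠ i ∧ k ≠ j := by
    clear * - hij
    revert i j
    decide
  obtain ⟨a, ha, hsa⟩ := hs i
  obtain ⟨b, hb, hsb⟩ := hs j
  obtain ⟨c, hc, hsc⟩ := hs k
  obtain ⟨a', ha', hta⟩ := ht i
  obtain ⟨b', hb', htb⟩ := ht j
  obtain ⟨c', hc', htc⟩ := ht k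
  refine h4 (isMinorOf_completeGraph_four ![insert s (D k), {t}, D i, D j] ?_ ?_ ?_)
  · intro m
    fin_cases m
    · exact connected_induce_insert (hD k) hc hsc
    · change (G.induce {t}).Connected
      exact Connected.of_subsingleton
    · exact hD i
    · exact hD j
  · intro m n hmn
    fin_cases m <;> fin_cases n <;> simp at hmn ⊢
    · exact ⟨hst.symm, htD k⟩
    · exact ⟨hsD i, hd k i hki⟩
    · exact ⟨hsD j, hd k j hkj⟩
    · exact htD i
    · exact htD j
    · exact hd i j hij
  · intro m n hmn
    fin_cases m <;> fin_cases n <;> simp at hmn ⊢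
    · exact Or.inr ⟨c', hc', htc.symm⟩
    · exact Or.inl ⟨a, ha, hsa⟩
    · exact Or.inl ⟨b, hb, hsb⟩
    · exact ⟨a', ha', hta⟩
    · exact ⟨b', hb', htb⟩
    · exact ⟨x, hx, y, hy, hxy⟩

/-- Three disjoint connected sets, pairwise separated by `{s, t}` and each closed under adjacency
in `G - {s, t}`, witness that `{s, t}` is b-rich when they are all adjacent to `s` and `t`. -/
theorem bRichSeparator_of_closed {V : Type} [Finite V] {G : SimpleGraph V} {s t : V} (hst : s ≠ t)
    {D : Fin 3 → Set V} (hD : ∀ i, (G.induce (D i)).Connected)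
    (hd : ∀ i j, i ≠ j → Disjoint (D i) (D j)) (hDS : ∀ i, D i ⊆ {s, t}ᶜ)
    (hs : ∀ i, ∃ c ∈ D i, G.Adj s c) (ht : ∀ i, ∃ c ∈ D i, G.Adj t c)
    (hcl : ∀ i, ∀ x ∈ D i, ∀ y ∈ ({s, t} : Set V)ᶜ, G.Adj x y → y ∈ D i) :
    BRichSeparator G {s, t} := by
  choose x hxD hx using hs
  choose y hyD hy using ht
  let K := G.induce ({s, t} : Set V)ᶜ
  let C : Fin 3 → K.ConnectedComponent := fun i => K.connectedComponentMk ⟨x i, hDS i (hxD i)⟩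
  have hmem : ∀ i (a b : ↥(({s, t} : Set V)ᶜ)), K.Walk a b → a.1 ∈ D i → b.1 ∈ D i := by
    intro i a b p
    induction p with
    | nil => exact id
    | cons h p ihp => exact fun ha => ihp (hcl i _ ha _ (Subtype.prop _) h)
  have hne : ∀ i j, i ≠ j → C i ≠ C j := by
    intro i j hij h
    obtain ⟨p⟩ := ConnectedComponent.exact h
    exact Set.disjoint_left.1 (hd i j hij) (hmem i _ _ p (hxD i)) (hxD j)
  have hblock : ∀ i, HasSBlock G {s, t} (C i) := by
    intro i
    refine hasSBlock_of_adj (x := ⟨x i, hDS i (hxD i)⟩) (y := ⟨y i, hDS i (hyD i)⟩) hst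
      rfl ?_ (hx i) (hy i)
    exact ConnectedComponent.sound
      (((hD i).preconnected ⟨y i, hyD i⟩ ⟨x i, hxD i⟩).map (induceHomOfLE G (hDS i)).toHom)
  refine ⟨?_, Set.ncard_pair hst, C 0, C 1, C 2, hne _ _ (by decide), hne _ _ (by decide),
    hne _ _ (by decide), hblock 0, hblock 1, hblock 2⟩
  have hadj_s : ∀ i, G.connectedComponentMk (x i) = G.connectedComponentMk s := fun i =>
    ConnectedComponent.sound (hx i).symm.reachable
  let φ : K.ConnectedComponent → G.ConnectedComponent :=
    ConnectedComponent.map (Embedding.induce _).toHom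
  have hφ : ∀ z : ↥(({s, t} : Set V)ᶜ),
      φ (K.connectedComponentMk z) = G.connectedComponentMk z.1 := fun z => rfl
  have hsurj : Function.Surjective φ := by
    intro c
    induction c using ConnectedComponent.ind with
    | _ v =>
    by_cases hv : v ∈ ({s, t} : Set V)
    · refine ⟨C 0, ?_⟩
      have h₀ : φ (C 0) = G.connectedComponentMk (x 0) := rfl
      rcases hv with rfl | rfl
      · rw [h₀, hadj_s]
      · have h₁ : φ (C 0) = φ (K.connectedComponentMk ⟨y 0, hDS 0 (hyD 0)⟩) := by
          congr 1
          exact ConnectedComponent.sound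
            (((hD 0).preconnected ⟨x 0, hxD 0⟩ ⟨y 0, hyD 0⟩).map (induceHomOfLE G (hDS 0)).toHom)
        rw [h₁, hφ]
        exact ConnectedComponent.sound (hy 0).symm.reachable
    · exact ⟨K.connectedComponentMk ⟨v, hv⟩, rfl⟩
  refine lt_of_le_of_ne (Nat.card_le_card_of_surjective φ hsurj) fun hcard => ?_
  have hinj := ((Nat.bijective_iff_surjective_and_card φ).2 ⟨hsurj, hcard.symm⟩).injective
  exact hne 0 1 (by decide) (hinj ((hadj_s 0).trans (hadj_s 1).symm))

/-- Every `K₄`-minor-free graph containing `K₂,₃` as a minor has a b-rich separator. -/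
theorem K4free_K23_has_bRich_separator {V : Type} [Finite V] (G : SimpleGraph V)
    (h4 : ¬ IsMinorOf (completeGraph (Fin 4)) G)
    (h23 : IsMinorOf (completeBipartiteGraph (Fin 2) (Fin 3)) G) :
    ∃ S : Set V, BRichSeparator G S := by
  classical
  obtain ⟨f, hf, hfd, hfa⟩ := h23
  obtain ⟨s, hsA, C, hC₀, hC₁, hC, hCd, hsC⟩ :=
    exists_adj_of_three_connected (f (.inl 0)) (fun i => f (.inr i)) (hf _) (fun i => hf _)
      (fun i j hij => hfd (by simpa using hij)) (fun i => hfd (by simp))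
      (fun i => hfa (by simp))
  have hAB : Disjoint (f (.inl 0)) (f (.inl 1)) := hfd (by simp)
  obtain ⟨t, htB, E, hE₀, hE₁, hE, hEd, htE⟩ :=
    exists_adj_of_three_connected (f (.inl 1)) C (hf _) hC hCd
      (fun i => (Disjoint.union_right (hfd (by simp))
        (hAB.symm.mono_right Set.sdiff_subset)).mono_right (hC₁ i))
      (fun i => by
        obtain ⟨a, ha, c, hc, hac⟩ := hfa (w := .inl 1) (w' := .inr i) (by simp)
        exact ⟨a, ha, c, hC₀ i hc, hac⟩)
  have hst : s ≠ t := fun h => Set.disjoint_left.1 hAB hsA (h ▸ htB)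
  have hAC : ∀ i, Disjoint (f (.inl 0)) (f (.inr i)) := fun i => hfd (by simp)
  have hBC : ∀ i, Disjoint (f (.inl 1)) (f (.inr i)) := fun i => hfd (by simp)
  have hES : ∀ i, E i ⊆ {s, t}ᶜ := by
    rintro i z hz (rfl | rfl)
    · rcases hE₁ i hz with h | h
      · rcases hC₁ i h with h | h
        · exact Set.disjoint_left.1 (hAC i) hsA h
        · exact h.2 rfl
      · exact Set.disjoint_left.1 hAB hsA h.1
    · rcases hE₁ i hz with h | h
      · rcases hC₁ i h with h | h
        · exact Set.disjoint_left.1 (hBC i) htB h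
        · exact Set.disjoint_left.1 hAB h.1 htB
      · exact h.2 rfl
  obtain ⟨D, hED, hDmax⟩ := Finite.exists_le_maximal
    (p := fun D : Fin 3 → Set V => (∀ i, (G.induce (D i)).Connected) ∧
      (∀ i j, i ≠ j → Disjoint (D i) (D j)) ∧ ∀ i, D i ⊆ {s, t}ᶜ) ⟨hE, hEd, hES⟩
  obtain ⟨hD, hDd, hDS⟩ := hDmax.prop
  have hs : ∀ i, ∃ c ∈ D i, G.Adj s c := fun i =>
    (hsC i).imp fun c hc => ⟨hED i (hE₀ i hc.1), hc.2⟩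
  have ht : ∀ i, ∃ c ∈ D i, G.Adj t c := fun i =>
    (htE i).imp fun c hc => ⟨hED i hc.1, hc.2⟩
  refine ⟨{s, t}, bRichSeparator_of_closed hst hD hDd hDS hs ht ?_⟩
  intro i x hx y hy hxy
  by_cases hyD : ∃ j, y ∈ D j
  · obtain ⟨j, hj⟩ := hyD
    by_cases hij : i = j
    · exact hij ▸ hj
    · exact (not_adj_of_K4free h4 hst hD hDd (fun i h => hDS i h (by simp))
        (fun i h => hDS i h (by simp)) hs ht hij hx hj hxy).elim
  push Not at hyD
  let D' : Fin 3 → Set V := Function.update D i (insert y (D i))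
  have hi : D' i = insert y (D i) := Function.update_self ..
  have hj : ∀ j, j ≠ i → D' j = D j := fun j h => Function.update_of_ne h ..
  have hle : D ≤ D' := by
    intro j
    by_cases h : j = i
    · subst h; rw [hi]; exact Set.subset_insert _ _
    · rw [hj j h]
  have hD' : D' ≤ D := by
    refine hDmax.le_of_ge ⟨fun j => ?_, fun j k hjk => ?_, fun j => ?_⟩ hle
    · by_cases h : j = i
      · subst h; rw [hi]; exact connected_induce_insert (hD j) hx hxy.symm
      · rw [hj j h]; exact hD j
    · by_cases h : j = i
      · subst h
        rw [hi, hj k hjk.symm, Set.disjoint_insert_left]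
        exact ⟨hyD k, hDd j k hjk⟩
      · by_cases h' : k = i
        · subst h'
          rw [hi, hj j hjk, Set.disjoint_insert_right]
          exact ⟨hyD j, hDd j k hjk⟩
        · rw [hj j h, hj k h']; exact hDd j k hjk
    · by_cases h : j = i
      · subst h; rw [hi]; exact Set.insert_subset hy (hDS j)
      · rw [hj j h]; exact hDS j
  exact hD' i (hi ▸ Set.mem_insert _ _)
end

section
/- Every biconnected graph on at least three vertices that has no K4-minor contains at least two vertices of degree 2. -/
open SimpleGraph

/-- The vertices `p 0, …, p k` are distinct, and consecutive ones are adjacent in `G`. -/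
structure IsPathSeq {V : Type} (G : SimpleGraph V) (k : ℕ) (p : ℕ → V) : Prop where
  inj : ∀ s t, s ≤ k → t ≤ k → p s = p t → s = t
  adj : ∀ t, t < k → G.Adj (p t) (p (t + 1))

namespace IsPathSeq

variable {V : Type} {G : SimpleGraph V} {k : ℕ} {p : ℕ → V}

theorem succ_le_card [Finite V] (hp : IsPathSeq G k p) : k + 1 ≤ Nat.card V := by
  have h : Function.Injective (fun i : Fin (k + 1) => p i) := fun i j hij =>
    Fin.ext (hp.inj i j (by omega) (by omega) hij)
  simpa using Nat.card_le_card_of_injective _ h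

theorem reverse (hp : IsPathSeq G k p) : IsPathSeq G k (fun t => p (k - t)) where
  inj s t hs ht h := by
    have := hp.inj _ _ (by omega) (by omega) h
    omega
  adj t ht := by
    have := (hp.adj (k - (t + 1)) (by omega)).symm
    rwa [show k - (t + 1) + 1 = k - t by omega] at this

/-- Adding the edge from `p 0` to `p (s + 1)` and removing that from `p s` to `p (s + 1)`. -/
theorem rotate (hp : IsPathSeq G k p) {s : ℕ} (hs : s + 1 ≤ k) (h : G.Adj (p 0) (p (s + 1))) :
    IsPathSeq G k (fun t => if t ≤ s then p (s - t) else p t) where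
  inj a b ha hb hab := by
    split_ifs at hab
    all_goals
      have := hp.inj _ _ (by omega) (by omega) hab
      omega
  adj t ht := by
    rcases lt_trichotomy t s with hts | rfl | hts
    · rw [if_pos (by omega), if_pos (by omega)]
      have := (hp.adj (s - (t + 1)) (by omega)).symm
      rwa [show s - (t + 1) + 1 = s - t by omega] at this
    · simpa using h
    · rw [if_neg (by omega), if_neg (by omega)]
      exact hp.adj t ht

theorem cons (hp : IsPathSeq G k p) {x : V} (hx : G.Adj x (p 0)) (h : ∀ m ≤ k, x ≠ p m) :
    IsPathSeq G (k + 1) (fun t => if t = 0 then x else p (t - 1)) where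
  inj a b ha hb hab := by
    split_ifs at hab
    · omega
    · exact (h _ (by omega) hab).elim
    · exact (h _ (by omega) hab.symm).elim
    · have := hp.inj _ _ (by omega) (by omega) hab
      omega
  adj t ht := by
    rcases t with _ | t
    · simpa using hx
    · simpa using hp.adj t (by omega)

/-- The first vertex of a path that cannot be made longer has all its neighbors on the path. -/
theorem exists_eq_of_adj (hp : IsPathSeq G k p) (hmax : ∀ q, ¬ IsPathSeq G (k + 1) q) {x : V}
    (hx : G.Adj (p 0) x) : ∃ m, 1 ≤ m ∧ m ≤ k ∧ x = p m := by
  by_contra! h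
  refine hmax _ (hp.cons hx.symm fun m hm => ?_)
  rcases m with _ | m
  · exact hx.ne'
  · exact h _ (by omega) hm

theorem connected_induce_image_Icc (hp : IsPathSeq G k p) {a b : ℕ} (hab : a ≤ b) (hb : b ≤ k) :
    (G.induce (p '' Set.Icc a b)).Connected := by
  rw [connected_iff_exists_forall_reachable]
  refine ⟨⟨p a, a, ⟨le_rfl, hab⟩, rfl⟩, ?_⟩
  rintro ⟨_, t, ⟨hat, htb⟩, rfl⟩
  induction t, hat using Nat.le_induction with
  | base => exact Reachable.refl _
  | succ t hat ih =>
    refine (ih (by omega)).trans (Adj.reachable ?_)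
    exact hp.adj t (by omega)

/-- Three edges between consecutive segments of a path that yield a `K₄` minor. -/
theorem isMinorOf_of_adj (hp : IsPathSeq G k p) {x x' y z w w' : ℕ}
    (hx : x < y) (hx' : x' < y) (hyz : y < z) (hw : z < w) (hw' : z < w') (hwk : w ≤ k)
    (hwk' : w' ≤ k) (hxz : G.Adj (p x) (p z)) (hxw : G.Adj (p x') (p w))
    (hyw : G.Adj (p y) (p w')) : IsMinorOf (completeGraph (Fin 4)) G := by
  let l : Fin 4 → ℕ := ![0, y, z, z + 1]
  let h : Fin 4 → ℕ := ![y - 1, z - 1, z, k]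
  have hlt : ∀ i j : Fin 4, i < j → h i < l j := by
    intro i j hij
    fin_cases i <;> fin_cases j <;> simp [h, l] at hij ⊢ <;> omega
  have hk : ∀ i, h i ≤ k := by
    intro i
    fin_cases i <;> simp [h] <;> omega
  have hdisj : ∀ i j : Fin 4, i < j →
      Disjoint (p '' Set.Icc (l i) (h i)) (p '' Set.Icc (l j) (h j)) := by
    intro i j hij
    rw [Set.disjoint_left]
    rintro _ ⟨s, ⟨_, hs⟩, rfl⟩ ⟨t, ⟨ht, ht'⟩, hts⟩
    have := hp.inj _ _ (ht'.trans (hk j)) (hs.trans (hk i)) hts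
    have := hlt i j hij
    omega
  have hadj : ∀ i j : Fin 4, i < j → ∃ s, (l i ≤ s ∧ s ≤ h i) ∧ ∃ t, (l j ≤ t ∧ t ≤ h j) ∧
      G.Adj (p s) (p t) := by
    have e : ∀ s, 1 ≤ s → s ≤ k → G.Adj (p (s - 1)) (p s) := fun s hs hsk => by
      have := hp.adj (s - 1) (by omega)
      rwa [show s - 1 + 1 = s by omega] at this
    intro i j hij
    fin_cases i <;> fin_cases j <;> simp only [l, h] <;> simp at hij ⊢
    · exact ⟨y - 1, by omega, y, by omega, e y (by omega) (by omega)⟩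
    · exact ⟨x, by omega, z, by omega, hxz⟩
    · exact ⟨x', by omega, w, by omega, hxw⟩
    · exact ⟨z - 1, by omega, z, by omega, e z (by omega) (by omega)⟩
    · exact ⟨y, by omega, w', by omega, hyw⟩
    · exact ⟨z, by omega, z + 1, by omega, hp.adj z (by omega)⟩
  refine ⟨fun i => p '' Set.Icc (l i) (h i), fun i => ?_, fun i j hij => ?_, fun i j hij => ?_⟩
  · refine hp.connected_induce_image_Icc ?_ (hk i)
    fin_cases i <;> simp [h, l] <;> omega
  · rcases lt_or_gt_of_ne hij with hij | hij
    · exact hdisj i j hij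
    · exact (hdisj j i hij).symm
  · rcases lt_or_gt_of_ne hij.ne with hij | hij
    · obtain ⟨s, hs, t, ht, hst⟩ := hadj i j hij
      exact ⟨_, ⟨s, hs, rfl⟩, _, ⟨t, ht, rfl⟩, hst⟩
    · obtain ⟨s, hs, t, ht, hst⟩ := hadj j i hij
      exact ⟨_, ⟨t, ht, rfl⟩, _, ⟨s, hs, rfl⟩, hst.symm⟩

end IsPathSeq

theorem exists_isPathSeq_maximal {V : Type} [Finite V] [Nonempty V] (G : SimpleGraph V) :
    ∃ k p, IsPathSeq G k p ∧ ∀ q, ¬ IsPathSeq G (k + 1) q := by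
  by_contra! h
  have hall : ∀ k, ∃ p, IsPathSeq G k p := by
    intro k
    induction k with
    | zero => exact ⟨fun _ => Classical.arbitrary V, fun s t hs ht _ => by omega,
        fun t ht => by omega⟩
    | succ k ih => exact ih.elim fun p hp => h k p hp
  obtain ⟨p, hp⟩ := hall (Nat.card V)
  have := hp.succ_le_card
  omega

/-- If at most one vertex `w` of a finite graph has fewer than three neighbors, then the graph
has a `K₄` minor. -/
theorem isMinorOf_K4_of_three_neighbors {V : Type} [Finite V] [Nontrivial V] (G : SimpleGraph V)
    (w : V) (hdeg : ∀ v, v ≠ w → ∀ c d, ∃ x, G.Adj v x ∧ x ≠ c ∧ x ≠ d) :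
    IsMinorOf (completeGraph (Fin 4)) G := by
  classical
  by_contra h4
  obtain ⟨k, p₀, hp₀, hmax⟩ := exists_isPathSeq_maximal G
  have third : ∀ p, IsPathSeq G k p → p 0 ≠ w → ∀ a, ∃ m, 2 ≤ m ∧ m ≤ k ∧ m ≠ a ∧
      G.Adj (p 0) (p m) := by
    intro p hp hw a
    obtain ⟨x, hx, hx1, hxa⟩ := hdeg _ hw (p 1) (p a)
    obtain ⟨m, hm1, hmk, rfl⟩ := hp.exists_eq_of_adj hmax hx
    have : m ≠ 1 := by rintro rfl; exact hx1 rfl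
    exact ⟨m, by omega, hmk, by rintro rfl; exact hxa rfl, hx⟩
  have two : ∀ p, IsPathSeq G k p → p 0 ≠ w → ∃ i j, 2 ≤ i ∧ i < j ∧ j ≤ k ∧
      G.Adj (p 0) (p i) ∧ G.Adj (p 0) (p j) := by
    intro p hp hw
    obtain ⟨i, hi, hik, -, hai⟩ := third p hp hw 0
    obtain ⟨j, hj, hjk, hij, haj⟩ := third p hp hw i
    rcases lt_or_gt_of_ne hij with h | h
    · exact ⟨j, i, hj, h, hik, haj, hai⟩
    · exact ⟨i, j, hi, h, hjk, hai, haj⟩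
  have hex : ∃ i, 2 ≤ i ∧ ∃ p, IsPathSeq G k p ∧ i ≤ k ∧ G.Adj (p 0) (p i) ∧
      ∀ t < i, p t ≠ w := by
    by_contra! hno
    have hk : k ≠ 0 := by
      rintro rfl
      obtain ⟨v, hv⟩ := exists_ne w
      obtain ⟨x, hx, -⟩ := hdeg v hv v v
      refine hmax (fun t => if t = 0 then v else x) ⟨fun s t hs ht hst => ?_, fun t ht => ?_⟩
      · split_ifs at hst
        · omega
        · exact (hx.ne hst).elim
        · exact (hx.ne hst.symm).elim
        · omega
      · obtain rfl : t = 0 := by omega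
        simpa using hx
    have hr := hp₀.reverse
    by_cases h0 : p₀ 0 = w
    · have hkw : p₀ (k - 0) ≠ w := fun h => by
        have := hp₀.inj _ _ (by omega) (by omega) (h.trans h0.symm)
        omega
      obtain ⟨i, j, hi, hij, hjk, hai, haj⟩ := two _ hr hkw
      obtain ⟨t, ht, htw⟩ := hno i hi _ hr (by omega) hai
      have := hp₀.inj _ _ (by omega) (by omega) (htw.trans h0.symm)
      omega
    obtain ⟨i, j, hi, hij, hjk, hai, haj⟩ := two _ hp₀ h0
    obtain ⟨t, ht, htw⟩ := hno i hi _ hp₀ (by omega) hai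
    by_cases h0' : p₀ (k - 0) = w
    · have := hp₀.inj _ _ (by omega) (by omega) (htw.trans h0'.symm)
      omega
    obtain ⟨i', j', hi', hij', hjk', hai', haj'⟩ := two _ hr h0'
    obtain ⟨t', ht', htw'⟩ := hno i' hi' _ hr (by omega) hai'
    have := hp₀.inj _ _ (by omega) (by omega) (htw.trans htw'.symm)
    exact h4 (hp₀.isMinorOf_of_adj (x := 0) (x' := 0) (y := k - i') (z := i) (w := j) (w' := k)
      (by omega) (by omega) (by omega) hij (by omega) hjk le_rfl hai haj hai'.symm)
  obtain ⟨hi, p, hp, hik, hai, hw⟩ := Nat.find_spec hex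
  have hmin := fun m hm => Nat.find_min hex (m := m) hm
  generalize Nat.find hex = i at *
  obtain ⟨j, hj, hjk, hji, haj⟩ := third p hp (hw 0 (by omega)) i
  have hij : i < j := by
    by_contra h
    exact hmin j (by omega) ⟨hj, p, hp, hjk, haj, fun t ht => hw t (by omega)⟩
  obtain ⟨s, rfl⟩ : ∃ s, i = s + 1 := ⟨i - 1, by omega⟩
  have hq := hp.rotate hik hai
  obtain ⟨m, hm, hmk, hms, ham⟩ := third _ hq (by simpa using hw s (by omega)) (s + 1)
  by_cases hms' : m ≤ s
  · refine hmin m (by omega) ⟨hm, _, hq, hmk, ham, fun t ht => ?_⟩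
    rw [if_pos (by omega)]
    exact hw _ (by omega)
  · simp only [Nat.zero_le, if_true, Nat.sub_zero, if_neg hms'] at ham
    exact h4 (hp.isMinorOf_of_adj (x := 0) (x' := 0) (y := s) (z := s + 1) (w := j) (w' := m)
      (by omega) (by omega) (by omega) hij (by omega) hjk hmk hai haj ham)

theorem KConnected.exists_two_neighbors {V : Type} [Nontrivial V] {G : SimpleGraph V}
    (h : KConnected 2 G) (v : V) : ∃ x y, x ≠ y ∧ G.Adj v x ∧ G.Adj v y := by
  obtain ⟨u, hu⟩ := exists_ne v
  obtain ⟨P, hinj, hpath, hdis⟩ := h hu.symm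
  have h01 : P 0 ≠ P 1 := fun h => absurd (hinj h) (by decide)
  have hd := hdis 0 1 (by decide)
  have hp0 := hpath 0
  have hp1 := hpath 1
  generalize P 0 = p at *
  generalize P 1 = q at *
  cases p with
  | nil => exact (hu rfl).elim
  | @cons _ x _ hx p =>
    cases q with
    | nil => exact (hu rfl).elim
    | @cons _ y _ hy q =>
      refine ⟨x, y, ?_, hx, hy⟩
      rintro rfl
      rcases hd x (by simp) (by simp) with rfl | rfl
      · exact hx.ne rfl
      · have hp := (Walk.isPath_iff_nil).1 hp0.of_cons
        have hq := (Walk.isPath_iff_nil).1 hp1.of_cons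
        exact h01 (by rw [Walk.eq_nil_iff_nil.2 hp, Walk.eq_nil_iff_nil.2 hq])

/-- Every biconnected `K₄`-minor-free graph on at least three vertices has at least two
vertices of degree 2. -/
theorem biconnected_K4free_two_degree_two {V : Type} [Finite V] (G : SimpleGraph V)
    (hcard : 3 ≤ Nat.card V) (hconn : KConnected 2 G)
    (h4 : ¬ IsMinorOf (completeGraph (Fin 4)) G) :
    ∃ u v : V, u ≠ v ∧ (G.neighborSet u).ncard = 2 ∧ (G.neighborSet v).ncard = 2 := by
  have : Nontrivial V := Finite.one_lt_card_iff_nontrivial.1 (by omega)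
  by_contra! hno
  obtain ⟨w, hw⟩ : ∃ w, ∀ v, v ≠ w → (G.neighborSet v).ncard ≠ 2 := by
    by_cases h : ∃ w, (G.neighborSet w).ncard = 2
    · obtain ⟨w, hw⟩ := h
      exact ⟨w, fun v hv => hno w v hv.symm hw⟩
    · push Not at h
      exact ⟨Classical.arbitrary V, fun v _ => h v⟩
  refine h4 (isMinorOf_K4_of_three_neighbors G w fun v hv c d => ?_)
  by_contra! hcd
  obtain ⟨x, y, hxy, hx, hy⟩ := hconn.exists_two_neighbors v
  refine hw v hv ?_
  have : G.neighborSet v = {x, y} := by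
    ext z
    simp only [mem_neighborSet, Set.mem_insert_iff, Set.mem_singleton_iff]
    constructor
    · intro hz
      by_contra! hxyz
      by_cases h1 : x = c <;> by_cases h2 : y = c <;> by_cases h3 : z = c <;> grind
    · rintro (rfl | rfl) <;> assumption
  rw [this, Set.ncard_pair hxy]
end

section
/- Every biconnected graph on at least three vertices that contains neither K4 nor the complete bipartite graph K(2,3) as a minor (i.e., every biconnected outerplanar graph) contains a Hamiltonian cycle, that is, a cycle passing through all of its vertices. -/
open SimpleGraph

namespace SimpleGraph.Walk

variable {V : Type} {G : SimpleGraph V} {u v : V}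

/-- Two walks with the same ends share no vertices other than these ends. -/
def InternallyDisjoint (p q : G.Walk u v) : Prop :=
  ∀ x, x ∈ p.support → x ∈ q.support → x = u ∨ x = v

lemma InternallyDisjoint.symm {p q : G.Walk u v} (h : p.InternallyDisjoint q) :
    q.InternallyDisjoint p :=
  fun x hq hp => h x hp hq

lemma InternallyDisjoint.isCycle_append_reverse {p q : G.Walk u v} (h : p.InternallyDisjoint q)
    (hp : p.IsPath) (hq : q.IsPath) (hl : 1 < p.length ∨ 1 < q.length) :
    (p.append q.reverse).IsCycle := by
  refine hp.isCycle_append (isPath_reverse_iff q |>.mpr hq) (fun x hxp hxq => ?_) (by simpa)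
  have hx := h x (List.mem_of_mem_tail hxp)
    (by simpa using List.mem_of_mem_tail hxq)
  have hpn := hp.support_nodup
  rw [← cons_tail_support] at hpn
  have hqn := (isPath_reverse_iff q |>.mpr hq).support_nodup
  rw [← cons_tail_support] at hqn
  grind

/-- A cycle through two distinct vertices splits into two internally disjoint paths
between them. -/
lemma IsCycle.exists_internallyDisjoint {w : V} {c : G.Walk w w} (hc : c.IsCycle)
    (hu : u ∈ c.support) (hv : v ∈ c.support) (huv : u ≠ v) :
    ∃ p q : G.Walk u v, p.IsPath ∧ q.IsPath ∧ p.InternallyDisjoint q ∧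
      p.length + q.length = c.length ∧
      ∀ x, x ∈ c.support ↔ x ∈ p.support ∨ x ∈ q.support := by
  classical
  have hcu := hc.rotate hu
  have hvu : v ∈ (c.rotate u hu).support := by rwa [mem_support_rotate_iff]
  obtain ⟨p, q, hpq⟩ := mem_support_iff_exists_append.mp hvu
  rw [hpq] at hcu
  have hdisj := hcu.support_nodup
  rw [tail_support_append, List.nodup_append'] at hdisj
  refine ⟨p, q.reverse, hcu.isPath_of_append_left (not_nil_of_ne huv.symm),
    (hcu.isPath_of_append_right (not_nil_of_ne huv)).reverse, fun x hxp hxq => ?_, ?_, fun x => ?_⟩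
  · rw [support_reverse, List.mem_reverse, mem_support_iff] at hxq
    rw [mem_support_iff] at hxp
    by_contra! hx
    exact hdisj.2.2 (hxp.resolve_left hx.1) (hxq.resolve_left hx.2)
  · rw [length_reverse, ← length_append, ← hpq, length_rotate]
  · rw [← mem_support_rotate_iff c u hu, hpq, mem_support_append_iff, support_reverse,
      List.mem_reverse]

/-- The interior of a path of length at least two is the support of a walk. -/
lemma IsPath.exists_interior {p : G.Walk u v} (hp : p.IsPath) (hl : 1 < p.length) :
    ∃ (a b : V) (r : G.Walk a b), G.Adj u a ∧ G.Adj b v ∧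
      ∀ x, x ∈ r.support ↔ x ∈ p.support ∧ x ≠ u ∧ x ≠ v := by
  cases p with
  | nil => simp at hl
  | cons h q =>
    cases q with
    | nil => simp at hl
    | cons h' q =>
      obtain ⟨b, r, hb, hr⟩ := exists_cons_eq_concat h' q
      rw [hr] at hp ⊢
      obtain ⟨hp, hu⟩ := (cons_isPath_iff _ _).mp hp
      obtain ⟨-, hv⟩ := (concat_isPath_iff hb).mp hp
      refine ⟨_, b, r, h, hb, fun x => ?_⟩
      simp only [support_cons, support_concat, List.mem_cons, List.mem_append] at hu ⊢
      grind

lemma IsCycle.length_le_card [Finite V] {c : G.Walk u u} (hc : c.IsCycle) :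
    c.length ≤ Nat.card V := by
  have := Fintype.ofFinite V
  rw [Nat.card_eq_fintype_card]
  simpa using hc.support_nodup.length_le_card

end SimpleGraph.Walk

section

open SimpleGraph.Walk

variable {V : Type} {G : SimpleGraph V}

/-- Three internally disjoint paths of length at least two with common distinct ends
yield a `K₂,₃` minor. -/
lemma isMinorOf_completeBipartiteGraph_two_three {u v : V} (huv : u ≠ v)
    (P : Fin 3 → G.Walk u v) (hP : ∀ i, (P i).IsPath) (hl : ∀ i, 1 < (P i).length)
    (hd : ∀ i j, i ≠ j → (P i).InternallyDisjoint (P j)) :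
    IsMinorOf (completeBipartiteGraph (Fin 2) (Fin 3)) G := by
  choose a b r ha hb hr using fun i => (hP i).exists_interior (hl i)
  have hur : ∀ i, u ∉ (r i).support := fun i h => ((hr i u).mp h).2.1 rfl
  have hvr : ∀ i, v ∉ (r i).support := fun i h => ((hr i v).mp h).2.2 rfl
  have key : ∀ (s : Fin 2) (i : Fin 3),
      ∃ x ∈ ({![u, v] s} : Set V), ∃ y ∈ {y | y ∈ (r i).support}, G.Adj x y := by
    intro s i
    refine ⟨_, rfl, ?_⟩
    fin_cases s
    · exact ⟨a i, (r i).start_mem_support, ha i⟩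
    · exact ⟨b i, (r i).end_mem_support, (hb i).symm⟩
  have hsr : ∀ (s : Fin 2) (i : Fin 3),
      Disjoint ({![u, v] s} : Set V) {y | y ∈ (r i).support} := by
    intro s i
    rw [Set.disjoint_singleton_left]
    fin_cases s
    · exact hur i
    · exact hvr i
  refine ⟨Sum.elim (fun s => {![u, v] s}) (fun i => {y | y ∈ (r i).support}), ?_, ?_, ?_⟩
  · rintro (s | i)
    · rw [Sum.elim_inl]
      exact ⟨.of_subsingleton⟩
    · exact (r i).connected_induce_support
  · rintro (s | i) (t | j) hne
    · simp only [Sum.elim_inl, Set.disjoint_singleton]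
      fin_cases s <;> fin_cases t <;> simp_all [huv.symm]
    · exact hsr s j
    · exact (hsr t i).symm
    · refine Set.disjoint_left.mpr fun x hxi hxj => ?_
      obtain ⟨hxi, hxu, hxv⟩ := (hr i x).mp hxi
      exact (hd i j (by simpa using hne) x hxi ((hr j x).mp hxj).1).elim hxu hxv
  · rintro (s | i) (t | j) hadj
    · simp at hadj
    · exact key s j
    · obtain ⟨x, hx, y, hy, hxy⟩ := key t i
      exact ⟨y, hy, x, hx, hxy.symm⟩
    · simp at hadj

lemma KConnected.exists_isCycle [Nontrivial V] (hG : KConnected 2 G) :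
    ∃ (v : V) (c : G.Walk v v), c.IsCycle := by
  obtain ⟨u, v, huv⟩ := exists_pair_ne V
  obtain ⟨P, hinj, hP, -⟩ := hG huv
  obtain ⟨w, _, p, q, -, -, hc⟩ :=
    (hP 0).exists_isCycle_of_ne (hP 1) (hinj.ne (by decide))
  exact ⟨w, _, hc⟩

lemma KConnected.exists_isPath_notMem (hG : KConnected 2 G) {u v w : V} (huv : u ≠ v)
    (hu : w ≠ u) (hv : w ≠ v) : ∃ p : G.Walk u v, p.IsPath ∧ w ∉ p.support := by
  obtain ⟨P, -, hP, hd⟩ := hG huv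
  by_cases h : w ∈ (P 0).support
  · exact ⟨P 1, hP 1, fun h' => (hd 0 1 (by decide) w h h').elim hu hv⟩
  · exact ⟨P 0, hP 0, h⟩

/-- In a 2-connected graph, every cycle that misses a vertex has an ear of length at least two:
a path between distinct vertices of the cycle whose interior avoids the cycle. -/
lemma KConnected.exists_ear (hG : KConnected 2 G) {w x : V} {c : G.Walk w w} (hc : c.IsCycle)
    (hx : x ∉ c.support) :
    ∃ (u v : V) (p : G.Walk u v), u ≠ v ∧ u ∈ c.support ∧ v ∈ c.support ∧ p.IsPath ∧
      1 < p.length ∧ ∀ y, y ∈ p.support → y ∈ c.support → y = u ∨ y = v := by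
  classical
  have hwx : w ≠ x := fun h => hx (h ▸ c.start_mem_support)
  obtain ⟨P, -, -, -⟩ := hG hwx
  obtain ⟨d, -, hd₁, hd₂⟩ :=
    (P 0).exists_boundary_dart {y | y ∈ c.support} c.start_mem_support hx
  obtain ⟨⟨u, y⟩, huy⟩ := d
  change u ∈ c.support at hd₁
  change y ∉ c.support at hd₂
  change G.Adj u y at huy
  obtain ⟨z, hz, hzu⟩ : ∃ z ∈ c.support, z ≠ u := by
    by_cases h : u = w
    · refine ⟨c.snd, c.getVert_mem_support 1, ?_⟩
      subst h
      exact (c.adj_snd hc.not_nil).ne'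
    · exact ⟨w, c.start_mem_support, Ne.symm h⟩
  obtain ⟨p, hp, hup⟩ := hG.exists_isPath_notMem (u := y) (v := z) (w := u)
    (fun h => hd₂ (h ▸ hz)) huy.ne hzu.symm
  obtain ⟨v, hvc, hvp, hv⟩ := p.exists_mem_support_forall_mem_support_imp_eq c.support.toFinset
    ⟨z, by simp [hz]⟩
  have huq : u ∉ (p.takeUntil v hvp).support :=
    fun h => hup (p.support_takeUntil_subset_support hvp h)
  rw [List.mem_toFinset] at hvc
  refine ⟨u, v, cons huy (p.takeUntil v hvp), fun h => hup (h ▸ hvp), hd₁, hvc,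
    (hp.takeUntil hvp).cons huq, ?_, fun t ht htc => ?_⟩
  · have : ¬ (p.takeUntil v hvp).Nil := not_nil_of_ne fun h => hd₂ (h ▸ hvc)
    rw [length_cons]
    have := not_nil_iff_lt_length.mp this
    omega
  · rw [support_cons, List.mem_cons] at ht
    exact ht.imp_right fun h => hv t (by simpa using htc) h

lemma KConnected.exists_longer_isCycle (hG : KConnected 2 G)
    (h23 : ¬ IsMinorOf (completeBipartiteGraph (Fin 2) (Fin 3)) G)
    {w x : V} {c : G.Walk w w} (hc : c.IsCycle) (hx : x ∉ c.support) :
    ∃ (v : V) (c' : G.Walk v v), c'.IsCycle ∧ c.length < c'.length := by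
  obtain ⟨u, v, r, huv, hu, hv, hr, hrl, hrc⟩ := hG.exists_ear hc hx
  obtain ⟨p, q, hp, hq, hpq, hlen, hsupp⟩ := hc.exists_internallyDisjoint hu hv huv
  have hrp : r.InternallyDisjoint p := fun y hy hyp => hrc y hy ((hsupp y).mpr (.inl hyp))
  have hrq : r.InternallyDisjoint q := fun y hy hyq => hrc y hy ((hsupp y).mpr (.inr hyq))
  by_cases hpl : 1 < p.length
  · by_cases hql : 1 < q.length
    · refine absurd (isMinorOf_completeBipartiteGraph_two_three huv ![p, q, r] ?_ ?_ ?_) h23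
      · intro i; fin_cases i <;> assumption
      · intro i; fin_cases i <;> assumption
      · intro i j hij
        fin_cases i <;> fin_cases j <;>
          first | exact absurd rfl hij | assumption | (apply InternallyDisjoint.symm; assumption)
    · refine ⟨u, _, hrp.isCycle_append_reverse hr hp (.inl hrl), ?_⟩
      rw [length_append, length_reverse]
      omega
  · refine ⟨u, _, hrq.isCycle_append_reverse hr hq (.inl hrl), ?_⟩
    rw [length_append, length_reverse]
    omega

end

/-- Every biconnected outerplanar graph (i.e. one with no `K₄` minor and no `K₂,₃` minor)
on at least three vertices has a Hamiltonian cycle. -/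
theorem biconnected_outerplanar_hamiltonian {V : Type} [Finite V] (G : SimpleGraph V)
    (hcard : 3 ≤ Nat.card V) (hconn : KConnected 2 G)
    (h4 : ¬ IsMinorOf (completeGraph (Fin 4)) G)
    (h23 : ¬ IsMinorOf (completeBipartiteGraph (Fin 2) (Fin 3)) G) :
    ∃ (v : V) (c : G.Walk v v), c.IsCycle ∧ ∀ x : V, x ∈ c.support := by
  have : Nontrivial V := Finite.one_lt_card_iff_nontrivial.mp (by omega)
  by_contra! hham
  have hlong : ∀ n : ℕ, ∃ (v : V) (c : G.Walk v v), c.IsCycle ∧ n ≤ c.length := by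
    intro n
    induction n with
    | zero =>
      obtain ⟨v, c, hc⟩ := hconn.exists_isCycle
      exact ⟨v, c, hc, Nat.zero_le _⟩
    | succ n ih =>
      obtain ⟨v, c, hc, hn⟩ := ih
      obtain ⟨x, hx⟩ := hham v c hc
      obtain ⟨v', c', hc', hlt⟩ := hconn.exists_longer_isCycle h23 hc hx
      exact ⟨v', c', hc', by omega⟩
  obtain ⟨v, c, hc, hn⟩ := hlong (Nat.card V + 1)
  have := hc.length_le_card
  omega
end

section
/- Let H be a finite set of connected graphs and let k be a natural number. If G belongs to obs(A_k(excl(H))) and G_1, ..., G_r are the connected components of G, then there exist positive integers k_1, ..., k_r with k_1 + ... + k_r = k + 1 such that for every i, the component G_i belongs to obs(A_{k_i - 1}(excl(H))). -/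
open SimpleGraph

/-- `G` excludes all graphs of the family `Hg` as minors. -/
def ExclMinors {ι : Type} {Hv : ι → Type} (Hg : ∀ i, SimpleGraph (Hv i))
    {V : Type} (G : SimpleGraph V) : Prop :=
  ∀ i, ¬ IsMinorOf (Hg i) G

/-- `G` is a `k`-apex of the class of graphs excluding the family `Hg` as minors:
removing at most `k` vertices yields a graph excluding all members of `Hg` as minors. -/
def KApexExcl {ι : Type} {Hv : ι → Type} (Hg : ∀ i, SimpleGraph (Hv i))
    (k : ℕ) {V : Type} (G : SimpleGraph V) : Prop :=
  ∃ s : Set V, s.Finite ∧ s.ncard ≤ k ∧ ExclMinors Hg (G.induce sᶜ)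

/-- `G` is a minor-obstruction for the class of `k`-apices of `excl(Hg)`. -/
def ObsKApexExcl {ι : Type} {Hv : ι → Type} (Hg : ∀ i, SimpleGraph (Hv i))
    (k : ℕ) {V : Type} (G : SimpleGraph V) : Prop :=
  ¬ KApexExcl Hg k G ∧
    ∀ (W : Type) [Finite W] (H : SimpleGraph W),
      IsMinorOf H G → IsEmpty (H ≃g G) → KApexExcl Hg k H

/-- `H` is a minor of `G` with all branch sets contained in `s`. -/
def IsMinorOn {W V : Type} (H : SimpleGraph W) (G : SimpleGraph V) (s : Set V) : Prop :=
  ∃ f : W → Set V,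
    (∀ w, f w ⊆ s) ∧
    (∀ w, (G.induce (f w)).Connected) ∧
    (∀ ⦃w w' : W⦄, w ≠ w' → Disjoint (f w) (f w')) ∧
    (∀ ⦃w w' : W⦄, H.Adj w w' → ∃ a ∈ f w, ∃ b ∈ f w', G.Adj a b)

lemma IsMinorOn.mono {W V : Type} {H : SimpleGraph W} {G : SimpleGraph V} {s t : Set V}
    (h : IsMinorOn H G s) (hst : s ⊆ t) : IsMinorOn H G t := by
  obtain ⟨f, hs, h⟩ := h
  exact ⟨f, fun w => (hs w).trans hst, h⟩

/-- An embedding identifies an induced subgraph with the subgraph induced by its image. -/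
noncomputable def induceImageIso {V₁ V₂ : Type} {G₁ : SimpleGraph V₁} {G₂ : SimpleGraph V₂}
    (φ : G₁ ↪g G₂) (s : Set V₁) : G₁.induce s ≃g G₂.induce (φ '' s) where
  toEquiv := Equiv.Set.image φ s φ.injective
  map_rel_iff' := by
    rintro ⟨a, ha⟩ ⟨b, hb⟩
    simp

lemma connected_induce_image_iff {V₁ V₂ : Type} {G₁ : SimpleGraph V₁} {G₂ : SimpleGraph V₂}
    (φ : G₁ ↪g G₂) (s : Set V₁) :
    (G₂.induce (φ '' s)).Connected ↔ (G₁.induce s).Connected :=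
  (induceImageIso φ s).connected_iff.symm

lemma isMinorOf_iff_isMinorOn_range {W V₁ V₂ : Type} {H : SimpleGraph W} {G₁ : SimpleGraph V₁}
    {G₂ : SimpleGraph V₂} (φ : G₁ ↪g G₂) :
    IsMinorOf H G₁ ↔ IsMinorOn H G₂ (Set.range φ) := by
  constructor
  · rintro ⟨f, hc, hd, ha⟩
    refine ⟨fun w => φ '' f w, fun w => Set.image_subset_range _ _,
      fun w => (connected_induce_image_iff φ _).2 (hc w),
      fun w w' hw => (Set.disjoint_image_iff φ.injective).2 (hd hw), fun w w' hw => ?_⟩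
    obtain ⟨a, h1, b, h2, hab⟩ := ha hw
    exact ⟨φ a, ⟨a, h1, rfl⟩, φ b, ⟨b, h2, rfl⟩, φ.map_adj_iff.2 hab⟩
  · rintro ⟨f, hs, hc, hd, ha⟩
    refine ⟨fun w => φ ⁻¹' f w, fun w => ?_, fun w w' hw => (hd hw).preimage _,
      fun w w' hw => ?_⟩
    · rw [← connected_induce_image_iff φ, Set.image_preimage_eq_of_subset (hs w)]
      exact hc w
    · obtain ⟨a, h1, b, h2, hab⟩ := ha hw
      obtain ⟨a, rfl⟩ := hs _ h1
      obtain ⟨b, rfl⟩ := hs _ h2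
      exact ⟨a, h1, b, h2, φ.map_adj_iff.1 hab⟩

/-- A connected minor lives in a single connected component. -/
lemma IsMinorOn.exists_component {W V : Type} {H : SimpleGraph W} {G : SimpleGraph V}
    {s : Set V} (hH : H.Connected) (h : IsMinorOn H G s) :
    ∃ C : G.ConnectedComponent, IsMinorOn H G (s ∩ C.supp) := by
  obtain ⟨f, hs, hc, hd, ha⟩ := h
  have hsame : ∀ w, ∀ a ∈ f w, ∀ b ∈ f w, G.Reachable a b := fun w a h1 b h2 =>
    ((hc w).preconnected ⟨a, h1⟩ ⟨b, h2⟩).map (Embedding.induce (f w)).toHom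
  have hne : ∀ w, ∃ a, a ∈ f w := fun w => by
    obtain ⟨a⟩ := (hc w).nonempty
    exact ⟨a, a.2⟩
  choose g hg using hne
  have hadj : ∀ w w', H.Adj w w' → G.Reachable (g w) (g w') := fun w w' hw => by
    obtain ⟨a, h1, b, h2, hab⟩ := ha hw
    exact ((hsame w _ (hg w) a h1).trans hab.reachable).trans (hsame w' b h2 _ (hg w'))
  have hreach : ∀ w w', G.Reachable (g w) (g w') := fun w w' => by
    obtain ⟨p⟩ := hH.preconnected w w'
    induction p with
    | nil => exact Reachable.refl _
    | cons h _ ih => exact (hadj _ _ h).trans ih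
  obtain ⟨w₀⟩ := hH.nonempty
  refine ⟨G.connectedComponentMk (g w₀), f, fun w a h1 => ⟨hs w h1, ?_⟩, hc, hd, ha⟩
  rw [ConnectedComponent.mem_supp_iff, ConnectedComponent.eq]
  exact (hsame w a h1 _ (hg w)).trans (hreach w w₀)

lemma kApexExcl_iff_exists_isMinorOn {ι : Type} {Hv : ι → Type} {Hg : ∀ i, SimpleGraph (Hv i)}
    {V₁ V₂ : Type} [Finite V₂] {G₁ : SimpleGraph V₁} {G₂ : SimpleGraph V₂} (φ : G₁ ↪g G₂)
    (k : ℕ) :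
    KApexExcl Hg k G₁ ↔
      ∃ s : Set V₂, s.ncard ≤ k ∧ ∀ i, ¬ IsMinorOn (Hg i) G₂ (Set.range φ \ s) := by
  have key : ∀ t : Set V₁, ∀ i, IsMinorOf (Hg i) (G₁.induce tᶜ) ↔
      IsMinorOn (Hg i) G₂ (Set.range φ \ φ '' t) := fun t i => by
    rw [isMinorOf_iff_isMinorOn_range ((Embedding.induce (G := G₁) tᶜ).trans φ),
      ← Set.image_compl_eq_range_sdiff_image φ.injective]
    congr!
    ext x
    simp
  have : Finite V₁ := Finite.of_injective φ φ.injective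
  constructor
  · rintro ⟨s, -, hk, h⟩
    exact ⟨φ '' s, (Set.ncard_image_le s.toFinite).trans hk, fun i => by
      rw [← key]; exact h i⟩
  · rintro ⟨s, hk, h⟩
    refine ⟨φ ⁻¹' s, Set.toFinite _, ?_, fun i => ?_⟩
    · rw [← Set.ncard_image_of_injective _ φ.injective]
      exact (Set.ncard_le_ncard (Set.image_preimage_subset _ _)).trans hk
    · rw [key, Set.image_preimage_eq_inter_range, Set.inter_comm, Set.sdiff_self_inter]
      exact h i

/-- The least `k` for which `G` is a `k`-apex of the class excluding `Hg`. -/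
noncomputable def apexNumber {ι : Type} {Hv : ι → Type} (Hg : ∀ i, SimpleGraph (Hv i))
    {V : Type} (G : SimpleGraph V) : ℕ :=
  sInf {k | KApexExcl Hg k G}

section

variable {ι : Type} {Hv : ι → Type} {Hg : ∀ i, SimpleGraph (Hv i)}

lemma KApexExcl.mono {V : Type} {G : SimpleGraph V} {k l : ℕ} (h : KApexExcl Hg k G)
    (hkl : k ≤ l) : KApexExcl Hg l G := by
  obtain ⟨s, hs, hk, h⟩ := h
  exact ⟨s, hs, hk.trans hkl, h⟩

lemma kApexExcl_apexNumber (hconn : ∀ i, (Hg i).Connected) {V : Type} [Finite V]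
    (G : SimpleGraph V) : KApexExcl Hg (apexNumber Hg G) G := by
  refine Nat.sInf_mem (s := {k | KApexExcl Hg k G})
    ⟨Set.univ.ncard, Set.univ, Set.toFinite _, le_rfl, ?_⟩
  rintro i ⟨f, hc, -⟩
  obtain ⟨w⟩ := (hconn i).nonempty
  obtain ⟨⟨⟨x, hx⟩, -⟩⟩ := (hc w).nonempty
  exact hx trivial

lemma kApexExcl_iff_apexNumber_le (hconn : ∀ i, (Hg i).Connected) {V : Type} [Finite V]
    (G : SimpleGraph V) (k : ℕ) : KApexExcl Hg k G ↔ apexNumber Hg G ≤ k :=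
  ⟨fun h => Nat.sInf_le h, fun h => (kApexExcl_apexNumber hconn G).mono h⟩

lemma range_induce {V : Type} {G : SimpleGraph V} (s : Set V) :
    Set.range (Embedding.induce (G := G) s) = s := by
  ext x
  simp

lemma sum_apexNumber_le_ncard (hconn : ∀ i, (Hg i).Connected) {V : Type} [Finite V]
    {G : SimpleGraph V} (P : Finset G.ConnectedComponent) (t s : Set V)
    (hP : ∀ C ∈ P, C.supp ⊆ t) (hs : ∀ i, ¬ IsMinorOn (Hg i) G (t \ s)) :
    ∑ C ∈ P, apexNumber Hg (G.induce C.supp) ≤ s.ncard := by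
  classical
  have hle : ∀ C ∈ P, apexNumber Hg (G.induce C.supp) ≤ (s ∩ C.supp).ncard := fun C hC => by
    rw [← kApexExcl_iff_apexNumber_le hconn,
      kApexExcl_iff_exists_isMinorOn (Embedding.induce C.supp)]
    refine ⟨s ∩ C.supp, le_rfl, fun i h => hs i (h.mono ?_)⟩
    rw [range_induce, Set.sdiff_inter_self_eq_sdiff]
    exact Set.sdiff_subset_sdiff_left (hP C hC)
  refine (Finset.sum_le_sum hle).trans ?_
  have := Fintype.ofFinite V
  calc ∑ C ∈ P, (s ∩ C.supp).ncard
      = ∑ C ∈ P, (s.toFinset.filter fun x => G.connectedComponentMk x = C).card := by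
        refine Finset.sum_congr rfl fun C _ => ?_
        rw [← Set.ncard_coe_finset]
        congr 1
        ext x
        simp [ConnectedComponent.mem_supp_iff]
    _ ≤ s.toFinset.card := by
        convert (Finset.sum_card_fiberwise_eq_card_filter s.toFinset P
          G.connectedComponentMk).trans_le (Finset.card_filter_le _ _)
    _ = s.ncard := (Set.ncard_eq_toFinset_card' s).symm

lemma kApexExcl_sum_apexNumber (hconn : ∀ i, (Hg i).Connected) {V : Type} [Finite V]
    (G : SimpleGraph V) [Fintype G.ConnectedComponent] :
    KApexExcl Hg (∑ C : G.ConnectedComponent, apexNumber Hg (G.induce C.supp)) G := by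
  have h : ∀ C : G.ConnectedComponent, _ := fun C =>
    (kApexExcl_iff_exists_isMinorOn (Embedding.induce C.supp) _).1
      (kApexExcl_apexNumber hconn (G.induce C.supp))
  choose S hcard hS using h
  rw [kApexExcl_iff_exists_isMinorOn (Embedding.refl (G := G))]
  refine ⟨⋃ C, S C, ?_, fun i hi => ?_⟩
  · exact (Set.ncard_iUnion_le_of_fintype S).trans (Finset.sum_le_sum fun C _ => hcard C)
  · obtain ⟨C, hC⟩ := hi.exists_component (hconn i)
    refine hS C i (hC.mono ?_)
    rw [range_induce]
    rintro x ⟨⟨-, hx⟩, hxC⟩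
    exact ⟨hxC, fun h => hx (Set.mem_iUnion.2 ⟨C, h⟩)⟩

end

/-- If a finite graph is isomorphic to a minor of itself, the minor model is an isomorphism. -/
lemma exists_iso_of_minor_model {W V : Type} [Finite V] {H : SimpleGraph W} {G : SimpleGraph V}
    (e : H ≃g G) {f : W → Set V} (hne : ∀ w, (f w).Nonempty)
    (hd : ∀ ⦃w w' : W⦄, w ≠ w' → Disjoint (f w) (f w'))
    (ha : ∀ ⦃w w' : W⦄, H.Adj w w' → ∃ a ∈ f w, ∃ b ∈ f w', G.Adj a b) :
    ∃ g : H ≃g G, ∀ w, f w = {g w} := by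
  choose g hg using hne
  have hinj : Function.Injective g := fun w w' h => by
    by_contra hw
    exact Set.disjoint_left.1 (hd hw) (hg w) (h ▸ hg w')
  have hsurj : Function.Surjective g := fun x => by
    obtain ⟨y, hy⟩ :=
      Finite.surjective_of_injective (hinj.comp e.symm.injective) x
    exact ⟨_, hy⟩
  have hf : ∀ w, f w = {g w} := fun w => by
    refine Set.eq_singleton_iff_unique_mem.2 ⟨hg w, fun x hx => ?_⟩
    obtain ⟨w', rfl⟩ := hsurj x
    by_contra hw
    exact Set.disjoint_left.1 (hd fun h => hw (congrArg g h).symm) hx (hg w')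
  have hadj : ∀ w w', H.Adj w w' → G.Adj (g w) (g w') := fun w w' h => by
    simpa [hf] using ha h
  have hadj' : ∀ w w', G.Adj (g w) (g w') → H.Adj w w' := fun w w' h => by
    let F : {p : V × V // G.Adj p.1 p.2} → {p : V × V // G.Adj p.1 p.2} := fun p =>
      ⟨(g (e.symm p.1.1), g (e.symm p.1.2)), hadj _ _ (e.symm.map_adj_iff.2 p.2)⟩
    have hF : Function.Injective F := by
      rintro ⟨⟨a, b⟩, _⟩ ⟨⟨c, d⟩, _⟩ h
      simpa [F, hinj.eq_iff] using h
    obtain ⟨⟨⟨a, b⟩, hab⟩, hp⟩ := Finite.surjective_of_injective hF ⟨(g w, g w'), h⟩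
    simp only [F, Subtype.mk.injEq, Prod.mk.injEq, hinj.eq_iff] at hp
    rw [← hp.1, ← hp.2]
    exact e.symm.map_adj_iff.2 hab
  exact ⟨⟨Equiv.ofBijective g ⟨hinj, hsurj⟩, fun {a b} => ⟨hadj' a b, hadj a b⟩⟩, hf⟩

lemma connected_induce_singleton {V : Type} (G : SimpleGraph V) (x : V) :
    (G.induce {x}).Connected :=
  { preconnected := fun a b => by
      rw [Subsingleton.elim a b]
    nonempty := ⟨⟨x, rfl⟩⟩ }

section

variable {ι : Type} {Hv : ι → Type} {Hg : ∀ i, SimpleGraph (Hv i)}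

lemma ObsKApexExcl.exists_isMinorOn_compl_singleton {k : ℕ} {V : Type} [Finite V]
    {G : SimpleGraph V} (hG : ObsKApexExcl Hg k G) (v : V) :
    ∃ s : Set V, s.ncard ≤ k ∧ ∀ i, ¬ IsMinorOn (Hg i) G ({v}ᶜ \ s) := by
  have h := hG.2 _ (G.induce {v}ᶜ) ?_ ⟨fun e => ?_⟩
  · simpa only [range_induce] using
      (kApexExcl_iff_exists_isMinorOn (Embedding.induce {v}ᶜ) k).1 h
  · refine ⟨fun w => {w.1}, fun w => connected_induce_singleton G _,
      fun w w' hw => ?_, fun w w' hw => ⟨w, rfl, w', rfl, hw⟩⟩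
    rw [Set.disjoint_singleton]
    exact fun h => hw (Subtype.ext h)
  · obtain ⟨x, hx⟩ := Finite.surjective_of_injective
      (Subtype.val_injective.comp e.symm.injective) v
    exact (e.symm x).2 hx

/-- Replacing a component `C` of `G` by a proper minor `H` of `C` yields a proper minor of `G`. -/
lemma ObsKApexExcl.kApexExcl_sum {k : ℕ} {V : Type} [Finite V] {G : SimpleGraph V}
    (hG : ObsKApexExcl Hg k G) (C : Set V) {W : Type} [Finite W]
    {H : SimpleGraph W} (hH : IsMinorOf H (G.induce C)) (hiso : IsEmpty (H ≃g G.induce C)) :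
    KApexExcl Hg k (H ⊕g G.induce Cᶜ) := by
  obtain ⟨f, hs, hc, hd, ha⟩ := (isMinorOf_iff_isMinorOn_range (Embedding.induce C)).1 hH
  rw [range_induce] at hs
  set F : W ⊕ ↑Cᶜ → Set V := Sum.elim f (fun x => {x.1})
  have hFc : ∀ w, (G.induce (F w)).Connected := by
    rintro (w | x)
    · exact hc w
    · exact connected_induce_singleton G _
  have hFd : ∀ ⦃w w'⦄, w ≠ w' → Disjoint (F w) (F w') := by
    rintro (w | x) (w' | x') hw
    · exact hd fun h => hw (h ▸ rfl)
    · exact Set.disjoint_singleton_right.2 fun h => x'.2 (hs w h)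
    · exact Set.disjoint_singleton_left.2 fun h => x.2 (hs w' h)
    · exact Set.disjoint_singleton.2 fun h => hw (by rw [Subtype.ext h])
  have hFa : ∀ ⦃w w'⦄, (H ⊕g G.induce Cᶜ).Adj w w' →
      ∃ a ∈ F w, ∃ b ∈ F w', G.Adj a b := by
    rintro (w | x) (w' | x') hw
    · exact ha hw
    · exact absurd hw Bool.false_ne_true
    · exact absurd hw Bool.false_ne_true
    · exact ⟨x, rfl, x', rfl, hw⟩
  refine hG.2 _ _ ⟨F, hFc, hFd, hFa⟩ ⟨fun e => ?_⟩
  obtain ⟨g, hg⟩ := exists_iso_of_minor_model e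
    (fun w => Set.nonempty_coe_sort.1 (hFc w).nonempty) hFd hFa
  have hgC : ∀ w, g (Sum.inl w) ∈ C := fun w =>
    hs w (by rw [show f w = {g (Sum.inl w)} from hg (Sum.inl w)]; rfl)
  refine hiso.false ⟨Equiv.ofBijective (fun w => ⟨g (Sum.inl w), hgC w⟩) ⟨fun w w' h => ?_, ?_⟩,
    fun {a b} => ?_⟩
  · simpa using h
  · rintro ⟨x, hx⟩
    obtain ⟨w | y, rfl⟩ := g.surjective x
    · exact ⟨w, rfl⟩
    · have : y.1 = g (Sum.inr y) := by
        have : ({y.1} : Set V) = {g (Sum.inr y)} := hg (Sum.inr y)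
        simpa using this
      exact (y.2 (this ▸ hx)).elim
  · exact g.map_adj_iff (v := Sum.inl a) (w := Sum.inl b)

end

/-- Dinneen's theorem: if `G` is an obstruction of `A_k(excl(H))` for a finite family `H`
of connected graphs, then there are positive integers `k_C`, one for each connected
component of `G`, summing to `k + 1`, such that each component is an obstruction of
`A_{k_C - 1}(excl(H))`. -/
theorem obstruction_components {ι : Type} [Finite ι] {Hv : ι → Type}
    [∀ i, Finite (Hv i)] (Hg : ∀ i, SimpleGraph (Hv i))
    (hconn : ∀ i, (Hg i).Connected) (k : ℕ)
    {V : Type} [Finite V] (G : SimpleGraph V) (hG : ObsKApexExcl Hg k G) :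
    ∃ κ : G.ConnectedComponent → ℕ,
      (∀ C, 1 ≤ κ C) ∧ (∑ᶠ C, κ C = k + 1) ∧
      ∀ C : G.ConnectedComponent, ObsKApexExcl Hg (κ C - 1) (G.induce C.supp) := by
  classical
  have := Fintype.ofFinite G.ConnectedComponent
  have hsupp : ∀ C D : G.ConnectedComponent, D ≠ C → D.supp ⊆ C.suppᶜ := by
    rintro C D hDC x hD hC
    exact hDC (hD.symm.trans hC)
  set κ : G.ConnectedComponent → ℕ := fun C => apexNumber Hg (G.induce C.supp)
  have hlow : k < ∑ C, κ C := by
    by_contra! h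
    exact hG.1 ((kApexExcl_sum_apexNumber hconn G).mono h)
  have hsplit : ∀ C, ∑ D, κ D = κ C + ∑ D ∈ Finset.univ.erase C, κ D := fun C =>
    (Finset.add_sum_erase _ _ (Finset.mem_univ C)).symm
  have hsum : ∑ C, κ C = k + 1 := by
    refine le_antisymm ?_ hlow
    obtain ⟨v⟩ : Nonempty V := by
      by_contra h
      have := not_nonempty_iff.1 h
      have : IsEmpty G.ConnectedComponent := ⟨fun C => C.ind fun v => h ⟨v⟩⟩
      simp at hlow
    obtain ⟨s, hs, hm⟩ := hG.exists_isMinorOn_compl_singleton v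
    refine (sum_apexNumber_le_ncard hconn Finset.univ Set.univ (insert v s)
      (fun _ _ => Set.subset_univ _) fun i h => hm i (h.mono ?_)).trans
      ((Set.ncard_insert_le v s).trans (by omega))
    rintro x ⟨-, hx⟩
    simpa [not_or] using hx
  have hpos : ∀ C, 1 ≤ κ C := fun C => by
    obtain ⟨v, hv⟩ := C.nonempty_supp
    obtain ⟨s, hs, hm⟩ := hG.exists_isMinorOn_compl_singleton v
    have h := sum_apexNumber_le_ncard hconn (Finset.univ.erase C) _ s (fun D hD =>
      (hsupp C D (Finset.ne_of_mem_erase hD)).trans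
        (Set.compl_subset_compl.2 (Set.singleton_subset_iff.2 hv))) hm
    have := hsplit C
    change ∑ D ∈ Finset.univ.erase C, κ D ≤ _ at h
    omega
  refine ⟨κ, hpos, by rw [finsum_eq_sum_of_fintype, hsum], fun C => ⟨fun h => ?_, ?_⟩⟩
  · have h1 : κ C ≤ κ C - 1 := (kApexExcl_iff_apexNumber_le hconn _ _).1 h
    have := hpos C
    omega
  · intro W _ H hH hiso
    obtain ⟨s, hs, hm⟩ := (kApexExcl_iff_exists_isMinorOn Embedding.refl k).1
      (hG.kApexExcl_sum C.supp hH hiso)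
    have hl : KApexExcl Hg (s ∩ Set.range Sum.inl).ncard H := by
      refine (kApexExcl_iff_exists_isMinorOn
        (Embedding.sumInl (G := H) (H := G.induce C.suppᶜ)) _).2
        ⟨_, le_rfl, fun i h => hm i (h.mono ?_)⟩
      rintro _ ⟨⟨w, rfl⟩, hw⟩
      exact ⟨⟨_, rfl⟩, fun h => hw ⟨h, w, rfl⟩⟩
    have hr : KApexExcl Hg (s ∩ Set.range Sum.inr).ncard (G.induce C.suppᶜ) := by
      refine (kApexExcl_iff_exists_isMinorOn
        (Embedding.sumInr (G := H) (H := G.induce C.suppᶜ)) _).2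
        ⟨_, le_rfl, fun i h => hm i (h.mono ?_)⟩
      rintro _ ⟨⟨w, rfl⟩, hw⟩
      exact ⟨⟨_, rfl⟩, fun h => hw ⟨h, w, rfl⟩⟩
    obtain ⟨t, ht, htm⟩ := (kApexExcl_iff_exists_isMinorOn (Embedding.induce _) _).1 hr
    rw [range_induce] at htm
    have hrest := sum_apexNumber_le_ncard hconn (Finset.univ.erase C) _ t
      (fun D hD => hsupp C D (Finset.ne_of_mem_erase hD)) htm
    have hcard : (s ∩ Set.range Sum.inl).ncard + (s ∩ Set.range Sum.inr).ncard ≤ s.ncard := by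
      rw [← Set.ncard_union_eq]
      · exact Set.ncard_le_ncard
          (Set.union_subset Set.inter_subset_left Set.inter_subset_left)
      · exact Set.isCompl_range_inl_range_inr.disjoint.mono
          Set.inter_subset_right Set.inter_subset_right
    have := hsplit C
    change ∑ D ∈ Finset.univ.erase C, κ D ≤ _ at hrest
    exact hl.mono (by omega)
end

section
/- A graph G is triconnected (and has at least four vertices) if and only if there is a sequence of graphs G_0, G_1, ..., G_q such that G_0 is isomorphic to the wheel W_r for some r >= 3, G_q = G, and for every i in {1,...,q}, either G_i is a splitting of G_{i-1}, or there exists an edge e of G_i with G_{i-1} = G_i minus e. -/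
open SimpleGraph

/-- The wheel `W_r`: a cycle on `r` vertices plus a central vertex joined to all of them. -/
def wheelGraph (r : ℕ) : SimpleGraph (Option (Fin r)) :=
  SimpleGraph.fromRel fun x y =>
    match x, y with
    | none, some _ => True
    | some i, some j => ((j : ℕ) = ((i : ℕ) + 1) % r)
    | _, _ => False

/-- The graph obtained from `G` by splitting the vertex `v` according to the partition
`{A, B}` of its neighborhood: `v` is replaced by two adjacent vertices, one joined to `A`
and the other joined to `B`. -/
def splitGraph {V : Type} (G : SimpleGraph V) (v : V) (A B : Set V) :
    SimpleGraph ({u : V // u ≠ v} ⊕ Bool) :=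
  SimpleGraph.fromRel fun x y =>
    match x, y with
    | Sum.inl a, Sum.inl b => G.Adj (a : V) (b : V)
    | Sum.inl a, Sum.inr t => (t = true ∧ (a : V) ∈ A) ∨ (t = false ∧ (a : V) ∈ B)
    | Sum.inr _, Sum.inr _ => True
    | _, _ => False

/-- `G'` is a splitting of `G`. -/
def IsSplittingOf {W V : Type} (G' : SimpleGraph W) (G : SimpleGraph V) : Prop :=
  ∃ (v : V) (A B : Set V), A ∪ B = G.neighborSet v ∧ Disjoint A B ∧
    2 ≤ A.ncard ∧ 2 ≤ B.ncard ∧ Nonempty (G' ≃g splitGraph G v A B)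

/-- One step of Tutte's wheel construction: either a splitting or an edge addition
(equivalently, the earlier graph is the later one with an edge deleted). -/
def WheelStep (p q : (W : Type) × SimpleGraph W) : Prop :=
  IsSplittingOf q.2 p.2 ∨ ∃ e ∈ q.2.edgeSet, Nonempty (p.2 ≃g q.2.deleteEdges {e})

/-- There is no vertex cut consisting of at most two vertices `s`, `t`. -/
def NoTwoCut {V : Type} (G : SimpleGraph V) : Prop :=
  ∀ (s t : V) (L : Set V), s ∉ L → t ∉ L → L.Nonempty →
    (∀ a ∈ L, ∀ b, G.Adj a b → b ∈ L ∨ b = s ∨ b = t) → ∀ v, v ∈ L ∨ v = s ∨ v = t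

lemma exists_ne_of_four_le_card {V : Type} (hc : 4 ≤ Nat.card V) (x s t : V) :
    ∃ v, v ≠ x ∧ v ≠ s ∧ v ≠ t := by
  classical
  have : Finite V := Nat.finite_of_card_ne_zero (by omega)
  have := Fintype.ofFinite V
  by_contra! hall
  have h1 : (Finset.univ : Finset V) ⊆ {x, s, t} := fun v _ => by
    have := hall v
    simp only [Finset.mem_insert, Finset.mem_singleton]
    tauto
  have h2 := Finset.card_le_card h1
  have h3 : ({x, s, t} : Finset V).card ≤ 3 := Finset.card_le_three
  rw [Finset.card_univ, ← Nat.card_eq_fintype_card] at h2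
  omega

/-- The vertex `x` has at most three neighbors. -/
def DegLeThree {V : Type} (G : SimpleGraph V) (x : V) : Prop :=
  ∃ a b c, ∀ w, G.Adj x w → w = a ∨ w = b ∨ w = c

/-- The ends `x`, `y` of an edge belong to a vertex cut with three vertices. -/
def InThreeCut {V : Type} (G : SimpleGraph V) (x y : V) : Prop :=
  ∃ (w l r : V) (L : Set V), x ∉ L ∧ y ∉ L ∧ w ∉ L ∧ l ∈ L ∧ r ∉ L ∧ r ≠ x ∧ r ≠ y ∧ r ≠ w ∧
    ∀ p ∈ L, ∀ q, G.Adj p q → q ∈ L ∨ q = x ∨ q = y ∨ q = w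

namespace NoTwoCut

variable {V : Type} {G : SimpleGraph V}

lemma eq_or_eq (h : NoTwoCut G) (s t v : V) (P : V → Prop) (hv : ¬ P v) (hs : v ≠ s) (ht : v ≠ t)
    (hP : ∀ a b, P a → a ≠ s → a ≠ t → G.Adj a b → P b ∨ b = s ∨ b = t) :
    ∀ a, P a → a = s ∨ a = t := by
  intro a ha
  by_contra! hne
  have := h s t {a | P a ∧ a ≠ s ∧ a ≠ t} (by simp) (by simp) ⟨a, ha, hne⟩
    (by
      rintro p ⟨hp, hps, hpt⟩ q hpq
      have := hP p q hp hps hpt hpq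
      simp only [Set.mem_ofPred_eq]
      tauto) v
  simp only [Set.mem_ofPred_eq] at this
  tauto

lemma exists_adj_ne (h : NoTwoCut G) (hc : 4 ≤ Nat.card V) (x s t : V) :
    ∃ w, G.Adj x w ∧ w ≠ s ∧ w ≠ t := by
  have key : ∀ s t, s ≠ x → t ≠ x → ∃ w, G.Adj x w ∧ w ≠ s ∧ w ≠ t := by
    intro s t hs ht
    by_contra! hcon
    obtain ⟨v, hvx, hvs, hvt⟩ := exists_ne_of_four_le_card hc x s t
    have := h.eq_or_eq s t v (fun a => a = x) hvx hvs hvt (by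
      rintro a b rfl - - hab
      have := hcon b hab
      tauto) x rfl
    tauto
  obtain ⟨v, hvx, -, -⟩ := exists_ne_of_four_le_card hc x s t
  have hirr : ∀ w, G.Adj x w → w ≠ x := fun w hw => hw.ne'
  by_cases hs : s = x
  · by_cases ht : t = x
    · obtain ⟨w, hw⟩ := key v v hvx hvx
      grind
    · obtain ⟨w, hw⟩ := key v t hvx ht
      grind
  · by_cases ht : t = x
    · obtain ⟨w, hw⟩ := key s v hs hvx
      grind
    · exact key s t hs ht

/-- If deleting the edge `xy` creates a cut with two vertices `a`, `b`, this describes the side of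
the cut containing `x`. -/
lemma exists_side_of_deleteEdges (h : NoTwoCut G) {x y : V}
    (hd : ¬ NoTwoCut (G.deleteEdges {s(x, y)})) :
    ∃ (X : Set V) (a b : V), x ∈ X ∧ y ∉ X ∧ a ∉ X ∧ b ∉ X ∧ y ≠ a ∧ y ≠ b ∧
      ∀ p ∈ X, ∀ q, G.Adj p q → q ∈ X ∨ q = a ∨ q = b ∨ (p = x ∧ q = y) := by
  unfold NoTwoCut at hd
  push Not at hd
  obtain ⟨s, t, L, hs, ht, hne, hcl, v, hvL, hvs, hvt⟩ := hd
  simp only [deleteEdges_adj, Set.mem_singleton_iff, Sym2.eq_iff, not_or, and_imp] at hcl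
  have hne' : ∃ p ∈ L, ∃ q, G.Adj p q ∧ q ∉ L ∧ q ≠ s ∧ q ≠ t := by
    by_contra! hcon
    have := h s t L hs ht hne (fun a ha b hab => by have := hcon a ha b hab; tauto) v
    tauto
  obtain ⟨p, hp, q, hpq, hqL, hqs, hqt⟩ := hne'
  have hpq' : (p = x ∧ q = y) ∨ (p = y ∧ q = x) := by
    by_contra hcon
    have := hcl p hp q hpq (by tauto) (by tauto)
    tauto
  rcases hpq' with ⟨rfl, rfl⟩ | ⟨rfl, rfl⟩
  · refine ⟨L, s, t, hp, hqL, hs, ht, hqs, hqt, fun a ha b hab => ?_⟩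
    have := hcl a ha b hab
    grind
  · refine ⟨{u | u ∉ L ∧ u ≠ s ∧ u ≠ t}, s, t, ⟨hqL, hqs, hqt⟩, by simp [hp], by simp, by simp,
      by grind, by grind, fun a ha b hab => ?_⟩
    simp only [Set.mem_ofPred_eq] at ha ⊢
    by_cases hb : b ∈ L
    · have := hcl b hb a hab.symm
      grind
    · grind

lemma degLeThree_of_triangle (h : NoTwoCut G) {x y z : V}
    (hxy : G.Adj x y) (hxz : G.Adj x z) (hyz : G.Adj y z)
    (hdy : ¬ NoTwoCut (G.deleteEdges {s(x, y)})) (hdz : ¬ NoTwoCut (G.deleteEdges {s(x, z)})) :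
    DegLeThree G x ∨ DegLeThree G y := by
  have side : ∀ y z, G.Adj x y → G.Adj x z → G.Adj y z →
      ¬ NoTwoCut (G.deleteEdges {s(x, y)}) → ∃ (X : Set V) (a : V), x ∈ X ∧ y ∉ X ∧ z ∉ X ∧ a ∉ X ∧
      y ≠ a ∧ ∀ p ∈ X, ∀ q, G.Adj p q → q ∈ X ∨ q = z ∨ q = a ∨ (p = x ∧ q = y) := by
    intro y z hxy hxz hyz hd
    obtain ⟨X, a, b, hx, hy, ha, hb, hya, hyb, hcl⟩ := h.exists_side_of_deleteEdges hd
    have h1 := hcl x hx z hxz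
    have h2 : z ∉ X := fun hz => by
      have := hcl z hz y hyz.symm
      have := hxz.ne
      grind
    have := hyz.ne
    rcases h1 with h1 | h1 | h1 | h1
    · grind
    · exact ⟨X, b, hx, hy, h2, hb, hyb, fun p hp q hpq => by have := hcl p hp q hpq; grind⟩
    · exact ⟨X, a, hx, hy, h2, ha, hya, fun p hp q hpq => by have := hcl p hp q hpq; grind⟩
    · grind
  obtain ⟨X, a, hxX, hyX, hzX, haX, hya, hX⟩ := side y z hxy hxz hyz hdy
  obtain ⟨X', b, hxX', hzX', hyX', hbX', hzb, hX'⟩ := side z y hxz hxy hyz.symm hdz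
  clear side hdy hdz
  have nxy := hxy.ne
  have nxz := hxz.ne
  have nyz := hyz.ne
  have adjX : ∀ p q, q ∈ X → G.Adj p q → p ∈ X ∨ p = z ∨ p = a ∨ (q = x ∧ p = y) :=
    fun p q hq hpq => hX q hq p hpq.symm
  have adjX' : ∀ p q, q ∈ X' → G.Adj p q → p ∈ X' ∨ p = y ∨ p = b ∨ (q = x ∧ p = z) :=
    fun p q hq hpq => hX' q hq p hpq.symm
  have degx : (∀ p ∈ X, p = x) → DegLeThree G x := fun hall =>
    ⟨y, z, a, fun w hw => by have := hX x hxX w hw; have := hall w; have := hw.ne; grind⟩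
  by_cases hbX : b ∈ X
  · -- `a ≠ b`
    have e1 := h.eq_or_eq y a x (fun p => p ∉ X ∧ p ≠ z ∧ p ≠ a ∧ p ∈ X') (by grind) (by grind)
      (by grind) (by intro p q hp _ _ hpq; have := hX' p hp.2.2.2 q hpq; have := adjX p q; grind)
    by_cases haX' : a ∈ X'
    · right
      have e2 := h.eq_or_eq y z x
        (fun p => p ∉ X ∧ p ≠ z ∧ p ≠ a ∧ p ∉ X' ∧ p ≠ y ∧ p ≠ b) (by grind) (by grind)
        (by grind) (by
          intro p q hp _ _ hpq; have := adjX' p q; have := adjX p q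
          grind)
      refine ⟨x, z, a, fun w hw => ?_⟩
      have := adjX y w
      have := adjX' y w
      have := hw.ne
      have := e1 w
      have := e2 w
      grind
    · left
      have e2 := h.eq_or_eq x b y (fun p => p ∈ X ∧ p ∈ X' ∧ p ≠ x) (by grind) (by grind)
        (by grind) (by
          intro p q hp _ _ hpq; have := hX' p hp.2.1 q hpq; have := hX p hp.1 q hpq
          grind)
      refine ⟨y, z, b, fun w hw => ?_⟩
      have := hX' x hxX' w hw
      have := hX x hxX w hw
      have := hw.ne
      have := e1 w
      have := e2 w
      grind
  · left
    apply degx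
    have e1 := h.eq_or_eq x a y (fun p => p ∈ X ∧ p ∈ X' ∧ p ≠ x) (by grind) (by grind)
        (by grind) (by
          intro p q hp _ _ hpq; have := hX' p hp.2.1 q hpq; have := hX p hp.1 q hpq
          grind)
    have e2 := h.eq_or_eq z a y (fun p => p ∈ X ∧ p ∉ X') (by grind) (by grind)
        (by grind) (by
          intro p q hp _ _ hpq; have := adjX' p q; have := hX p hp.1 q hpq
          grind)
    intro p hp
    have hpa : p ≠ a := fun hpa => haX (hpa ▸ hp)
    by_contra hpx
    by_cases hp' : p ∈ X'
    · have := e1 p ⟨hp, hp', hpx⟩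
      tauto
    · have := e2 p ⟨hp, hp'⟩
      grind

lemma degLeThree_of_inThreeCut (h : NoTwoCut G) {x y : V} (hxy : G.Adj x y)
    (hd : ¬ NoTwoCut (G.deleteEdges {s(x, y)})) (hc : InThreeCut G x y) :
    DegLeThree G x ∨ DegLeThree G y := by
  obtain ⟨X, a, b, hxX, hyX, haX, hbX, hya, hyb, hX⟩ := h.exists_side_of_deleteEdges hd
  obtain ⟨w, l, r, L, hxL, hyL, hwL, hlL, hrL, hrx, hry, hrw, hL⟩ := hc
  have nxy := hxy.ne
  clear hd
  have adjX : ∀ p q, q ∈ X → G.Adj p q → p ∈ X ∨ p = a ∨ p = b ∨ (q = x ∧ p = y) :=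
    fun p q hq hpq => hX q hq p hpq.symm
  have adjL : ∀ p q, q ∈ L → G.Adj p q → p ∈ L ∨ p = x ∨ p = y ∨ p = w :=
    fun p q hq hpq => hL q hq p hpq.symm
  have hlxy : ¬ (l = x ∨ l = y) := by grind
  have hwxy : w ≠ x ∧ w ≠ y := by
    by_contra hcon
    refine hlxy (h.eq_or_eq x y r (fun p => p ∈ L) hrL hrx hry ?_ l hlL)
    intro p q hp _ _ hpq
    have := hL p hp q hpq
    grind
  obtain ⟨hwx, hwy⟩ := hwxy
  -- a side `K` of the cut `x`, `y`, `w` meets `{a, b}`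
  have meet : ∀ K : Set V, x ∉ K → y ∉ K → w ∉ K → K.Nonempty →
      (∀ p ∈ K, ∀ q, G.Adj p q → q ∈ K ∨ q = x ∨ q = y ∨ q = w) → a ∈ K ∨ b ∈ K := by
    rintro K hxK hyK hwK ⟨k, hk⟩ hK
    by_contra! hab
    obtain ⟨haK, hbK⟩ := hab
    by_cases hkX : k ∈ X
    · have := h.eq_or_eq x w y (fun p => p ∈ K ∧ p ∈ X) (by grind) nxy.symm hwy.symm (by
        intro p q hp _ _ hpq; have := hK p hp.1 q hpq; have := hX p hp.2 q hpq; grind) k ⟨hk, hkX⟩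
      grind
    · have := h.eq_or_eq y w x (fun p => p ∈ K ∧ p ∉ X) (by grind) nxy hwx.symm (by
        intro p q hp _ _ hpq; have := hK p hp.1 q hpq; have := adjX p q; grind) k ⟨hk, hkX⟩
      grind
  have corner : ∀ (K : Set V) (c c' : V), x ∉ K → y ∉ K → w ∉ K →
      (a = c ∧ b = c' ∨ a = c' ∧ b = c) →
      c ∈ K → c' ∉ K →
      (∀ p ∈ K, ∀ q, G.Adj p q → q ∈ K ∨ q = x ∨ q = y ∨ q = w) →
      (w ∈ X → ∀ p ∈ K, p ∉ X → p = c) ∧ (w ∉ X → w ≠ c' → ∀ p ∈ K, p ∉ X) := by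
    intro K c c' hxK hyK hwK habc hcK hcK' hK
    constructor
    · intro hwX p hp hpX
      have := h.eq_or_eq y c x (fun p => p ∈ K ∧ p ∉ X) (by grind) nxy (by grind) (by
        intro p q hp _ _ hpq; have := hK p hp.1 q hpq; have := adjX p q; grind) p ⟨hp, hpX⟩
      grind
    · intro hwX hwc p hp hpX
      have := h.eq_or_eq x c y (fun p => p ∈ K ∧ p ∈ X) (by grind) nxy.symm (by grind) (by
        intro p q hp _ _ hpq; have := hK p hp.1 q hpq; have := hX p hp.2 q hpq; grind) p ⟨hp, hpX⟩
      grind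
  have hR : ∀ p ∈ {p | p ∉ L ∧ p ≠ x ∧ p ≠ y ∧ p ≠ w}, ∀ q, G.Adj p q →
      q ∈ {p | p ∉ L ∧ p ≠ x ∧ p ≠ y ∧ p ≠ w} ∨ q = x ∨ q = y ∨ q = w := by
    intro p hp q hpq
    have := hL q
    have := hpq.symm
    simp only [Set.mem_ofPred_eq] at hp ⊢
    grind
  have mL := meet L hxL hyL hwL ⟨l, hlL⟩ hL
  have mR := meet {p | p ∉ L ∧ p ≠ x ∧ p ≠ y ∧ p ≠ w} (by simp) (by simp) (by simp)
    ⟨r, hrL, hrx, hry, hrw⟩ hR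
  obtain ⟨c, c', habc, hcL, hcL', hcx', hcy', hcw'⟩ : ∃ c c', (a = c ∧ b = c' ∨ a = c' ∧ b = c) ∧
      c ∈ L ∧ c' ∉ L ∧ c' ≠ x ∧ c' ≠ y ∧ c' ≠ w := by
    simp only [Set.mem_ofPred_eq] at mR
    grind
  have cL := corner L c c' hxL hyL hwL habc hcL hcL' hL
  have cR := corner {p | p ∉ L ∧ p ≠ x ∧ p ≠ y ∧ p ≠ w} c' c (by simp) (by simp) (by simp)
    (by tauto) ⟨hcL', hcx', hcy', hcw'⟩ (by simp [hcL]) hR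
  simp only [Set.mem_ofPred_eq] at cR
  have hwc : w ≠ c := by grind
  by_cases hwX : w ∈ X
  · right
    refine ⟨x, c, c', fun v hv => ?_⟩
    have := adjX y v
    have := cL.1 hwX v
    have := cR.1 hwX v
    have := hv.ne
    grind
  · left
    refine ⟨y, c, c', fun v hv => ?_⟩
    have := hX x hxX v hv
    have := cL.2 hwX hcw'.symm v
    have := cR.2 hwX hwc v
    have := hv.ne
    grind

lemma exists_triangle_of_inThreeCut (h : NoTwoCut G) (hc : 4 ≤ Nat.card V) {x a b c : V}
    (hx : ∀ w, G.Adj x w ↔ w = a ∨ w = b ∨ w = c) (hab : a ≠ b) (hac : a ≠ c) (hbc : b ≠ c)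
    (ha : InThreeCut G x a) (hb : InThreeCut G x b ∨ ∃ w, G.Adj x w ∧ G.Adj b w) :
    ∃ w, G.Adj x w ∧ G.Adj a w := by
  by_contra! hcon
  have nab : ¬ G.Adj a b := hcon b (by simp [hx])
  have nac : ¬ G.Adj a c := hcon c (by simp [hx])
  have hxa : G.Adj x a := by simp [hx]
  have hxb : G.Adj x b := by simp [hx]
  have hxc : G.Adj x c := by simp [hx]
  -- a cut through the edge `xu` separates the other two neighbors of `x`
  have cut : ∀ u v v', (∀ w, G.Adj x w ↔ w = u ∨ w = v ∨ w = v') → InThreeCut G x u → u ≠ v →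
      u ≠ v' → ∃ (w : V) (L : Set V), x ∉ L ∧ u ∉ L ∧ w ∉ L ∧ v ∈ L ∧ v' ∉ L ∧ v' ≠ w ∧
        ∀ p ∈ L, ∀ q, G.Adj p q → q ∈ L ∨ q = x ∨ q = u ∨ q = w := by
    rintro u v v' hx' ⟨w, l, r, L, hxL, huL, hwL, hlL, hrL, hrx, hru, hrw, hL⟩ huv huv'
    have hxu := (hx' u).2 (Or.inl rfl)
    have hxs : ∀ w, G.Adj w x → w = u ∨ w = v ∨ w = v' := fun w hw => (hx' w).1 hw.symm
    have nxv := ((hx' v).2 (by simp)).ne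
    have nxv' := ((hx' v').2 (by simp)).ne
    have e1 : v ∈ L ∨ v' ∈ L := by
      by_contra! hno
      have := h.eq_or_eq u w r (fun p => p ∈ L) hrL hru hrw (by
        intro p q hp _ _ hpq; have := hL p hp q hpq; have := hxs p; grind) l hlL
      grind
    have e2 : (v ∉ L ∧ v ≠ w) ∨ (v' ∉ L ∧ v' ≠ w) := by
      by_contra hno
      have := h.eq_or_eq u w l (fun p => p ∉ L ∧ p ≠ x) (by grind) (by grind) (by grind) (by
        intro p q hp _ _ hpq; have := hL q; have := hxs p; have := hpq.symm; grind) r ⟨hrL, hrx⟩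
      grind
    by_cases hvL : v ∈ L
    · exact ⟨w, L, hxL, huL, hwL, hvL, by grind, by grind, hL⟩
    · refine ⟨w, {p | p ∉ L ∧ p ≠ x ∧ p ≠ u ∧ p ≠ w}, by simp, by simp, by simp, by grind, by grind,
        by grind, fun p hp q hpq => ?_⟩
      have := hL q
      have := hpq.symm
      simp only [Set.mem_ofPred_eq] at hp ⊢
      grind
  obtain ⟨w, L, hxL, haL, hwL, hbL, hcL, hcw, hL⟩ := cut a b c hx ha hab hac
  have nbc : ¬ G.Adj b c := fun hadj => by
    have := hL b hbL c hadj
    have := hxc.ne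
    grind
  replace hb : InThreeCut G x b := by
    refine hb.resolve_right ?_
    rintro ⟨u, hu, hbu⟩
    have := (hx u).1 hu
    have := hbu.ne
    have := fun h : G.Adj b a => nab h.symm
    grind
  obtain ⟨u, M, hxM, hbM, huM, haM, hcM, hcu, hM⟩ :=
    cut b a c (fun w => by rw [hx]; tauto) hb hab.symm hbc
  clear cut
  have nxa := hxa.ne
  have nxb := hxb.ne
  have nxc := hxc.ne
  have adjM : ∀ p q, q ∈ M → G.Adj p q → p ∈ M ∨ p = x ∨ p = b ∨ p = u :=
    fun p q hq hpq => hM q hq p hpq.symm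
  have adjL : ∀ p q, q ∈ L → G.Adj p q → p ∈ L ∨ p = x ∨ p = a ∨ p = w :=
    fun p q hq hpq => hL q hq p hpq.symm
  have hxs : ∀ w, G.Adj x w → w = a ∨ w = b ∨ w = c := fun w hw => (hx w).1 hw
  have hxs' : ∀ w, G.Adj w x → w = a ∨ w = b ∨ w = c := fun w hw => (hx w).1 hw.symm
  have eRN : ∀ w', (∀ q, (q = w ∧ q ∉ M) ∨ (q = u ∧ q ∉ L) → q = x ∨ q = w') → c ≠ w' → a ≠ w' →
      False := by
    intro w' hw' hcw' haw'
    have := h.eq_or_eq x w' a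
      (fun p => p ∉ L ∧ p ∉ M ∧ p ≠ a ∧ p ≠ b ∧ p ≠ w ∧ p ≠ u) (by grind) nxa.symm haw' (by
        intro p q hp _ _ hpq; have := adjL p q; have := adjM p q; have := hw' q; grind) c
      ⟨hcL, hcM, hac.symm, hbc.symm, hcw, hcu⟩
    grind
  have hau : a ≠ u := by grind
  have hbw : b ≠ w := by grind
  have hwM : w ∉ M := fun hwM => eRN u (by grind) hcu hau
  have hwa : w ≠ a := by grind
  have huL : u ∉ L := fun huL => eRN w (by grind) hcw hwa.symm
  have hwu : w ≠ u := by
    rintro rfl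
    exact eRN w (by grind) hcw hwa.symm
  have e1 := h.eq_or_eq b w a (fun p => p ∈ L ∧ p ∉ M) (by grind) hab hwa.symm (by
    intro p q hp _ _ hpq; have := adjM p q; have := hL p hp.1 q hpq; have := hxs' p; grind)
  have e2 := h.eq_or_eq a b c (fun p => p ∈ L ∧ p ∈ M) (by grind) hac.symm hbc.symm (by
    intro p q hp _ _ hpq; have := hM p hp.2 q hpq; have := hL p hp.1 q hpq; have := hxs' p; grind)
  have hLb : ∀ p ∈ L, p = b := by
    intro p hp
    by_cases hpM : p ∈ M
    · have := e2 p ⟨hp, hpM⟩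
      grind
    · have := e1 p ⟨hp, hpM⟩
      grind
  obtain ⟨v, hv, hvx, hvw⟩ := h.exists_adj_ne hc b x w
  have := hL b hbL v hv
  have := hv.ne
  have := hLb v
  have := fun h : G.Adj b a => nab h.symm
  grind

end NoTwoCut

/-- The vertex `b` is adjacent to all others, each of which has exactly two further neighbors. -/
def IsHub {V : Type} (G : SimpleGraph V) (b : V) : Prop :=
  ∀ v, v ≠ b → ∃ p q, p ≠ q ∧ p ≠ b ∧ q ≠ b ∧ ∀ w, G.Adj v w ↔ w = b ∨ w = p ∨ w = q

namespace NoTwoCut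

variable {V : Type} {G : SimpleGraph V}

lemma exists_neighbors_of_degLeThree (h : NoTwoCut G) (hc : 4 ≤ Nat.card V) {x : V}
    (hx : DegLeThree G x) :
    ∃ a b c, a ≠ b ∧ a ≠ c ∧ b ≠ c ∧ ∀ w, G.Adj x w ↔ w = a ∨ w = b ∨ w = c := by
  obtain ⟨a, b, c, habc⟩ := hx
  obtain ⟨u, hu, hua, hub⟩ := h.exists_adj_ne hc x a b
  obtain ⟨v, hv, hva, hvc⟩ := h.exists_adj_ne hc x a c
  obtain ⟨w, hw, hwb, hwc⟩ := h.exists_adj_ne hc x b c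
  refine ⟨a, b, c, ?_, ?_, ?_, fun z => ⟨habc z, ?_⟩⟩
  all_goals grind

lemma not_degLeThree_of_twins (h : NoTwoCut G) (hc : 5 ≤ Nat.card V) {x a b c : V}
    (hx : ∀ w, G.Adj x w ↔ w = a ∨ w = b ∨ w = c) (hab : G.Adj a b) (hac : G.Adj a c)
    (hbc : b ≠ c) : ¬ DegLeThree G a := by
  classical
  intro ha
  obtain ⟨p, q, r, hpq, hpr, hqr, hN⟩ := h.exists_neighbors_of_degLeThree (by omega) ha
  have hxa : G.Adj x a := by simp [hx]
  have hxb : G.Adj x b := by simp [hx]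
  have hxc : G.Adj x c := by simp [hx]
  have hNa : ∀ w, G.Adj a w → w = x ∨ w = b ∨ w = c := by
    have := (hN x).1 hxa.symm
    have := (hN b).1 hab
    have := (hN c).1 hac
    have := hxb.ne
    have := hxc.ne
    intro w hw
    have := (hN w).1 hw
    grind
  obtain ⟨v, hv⟩ : ∃ v, v ∉ ({x, a, b, c} : Finset V) := by
    have : Finite V := Nat.finite_of_card_ne_zero (by omega)
    have := Fintype.ofFinite V
    by_contra! hall
    have h2 := Finset.card_le_card (fun v _ => hall v : (Finset.univ : Finset V) ⊆ {x, a, b, c})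
    have h3 : ({x, a, b, c} : Finset V).card ≤ 4 := Finset.card_le_four
    rw [Finset.card_univ, ← Nat.card_eq_fintype_card] at h2
    omega
  simp only [Finset.mem_insert, Finset.mem_singleton, not_or] at hv
  have := h.eq_or_eq b c v (fun w => w = x ∨ w = a) (by tauto) (by tauto) (by tauto) (by
    rintro s t (rfl | rfl) - - hst
    · have := (hx t).1 hst
      tauto
    · have := hNa t hst
      tauto) a (Or.inr rfl)
  have := hab.ne
  have := hac.ne
  tauto

theorem exists_isHub (h : NoTwoCut G) (hc : 5 ≤ Nat.card V)
    (hdel : ∀ x y, G.Adj x y → ¬ NoTwoCut (G.deleteEdges {s(x, y)}))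
    (hcon : ∀ x y, G.Adj x y → InThreeCut G x y ∨ ∃ w, G.Adj x w ∧ G.Adj y w) :
    ∃ b, IsHub G b := by
  have hc4 : 4 ≤ Nat.card V := by omega
  have triangle : ∀ x y z, G.Adj x y → G.Adj x z → G.Adj y z → DegLeThree G x ∨ DegLeThree G y :=
    fun x y z hxy hxz hyz => h.degLeThree_of_triangle hxy hxz hyz (hdel x y hxy) (hdel x z hxz)
  have edge : ∀ x y, G.Adj x y → DegLeThree G x ∨ DegLeThree G y := by
    intro x y hxy
    rcases hcon x y hxy with hcut | ⟨w, hxw, hyw⟩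
    · exact h.degLeThree_of_inThreeCut hxy (hdel x y hxy) hcut
    · exact triangle x y w hxy hxw hyw
  have inTriangle : ∀ x a b c, a ≠ b → a ≠ c → b ≠ c →
      (∀ w, G.Adj x w ↔ w = a ∨ w = b ∨ w = c) → G.Adj a b ∨ G.Adj a c := by
    intro x a b c hab hac hbc hx
    obtain ⟨w, hxw, haw⟩ : ∃ w, G.Adj x w ∧ G.Adj a w := by
      rcases hcon x a (by simp [hx]) with hcut | hw
      · exact h.exists_triangle_of_inThreeCut hc4 hx hab hac hbc hcut (hcon x b (by simp [hx]))
      · exact hw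
    rcases (hx w).1 hxw with rfl | rfl | rfl
    · exact (haw.ne rfl).elim
    · exact Or.inl haw
    · exact Or.inr haw
  have path : ∀ x a b c, a ≠ b → a ≠ c → b ≠ c →
      (∀ w, G.Adj x w ↔ w = a ∨ w = b ∨ w = c) → G.Adj a b → G.Adj b c →
      DegLeThree G a ∧ DegLeThree G c ∧ ¬ DegLeThree G b := by
    intro x a b c hab hac hbc hx hadj hadj'
    have hb := h.not_degLeThree_of_twins hc (x := x) (a := b) (b := a) (c := c)
      (fun w => by rw [hx]; tauto) hadj.symm hadj' hac
    have ha := triangle a b x hadj (hx a |>.2 (by simp)).symm (hx b |>.2 (by simp)).symm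
    have hc := triangle c b x hadj'.symm (hx c |>.2 (by simp)).symm (hx b |>.2 (by simp)).symm
    tauto
  have hub : ∀ x, DegLeThree G x → ∃ a b c, a ≠ b ∧ a ≠ c ∧ b ≠ c ∧
      (∀ w, G.Adj x w ↔ w = b ∨ w = a ∨ w = c) ∧ G.Adj a b ∧ G.Adj b c ∧
      DegLeThree G a ∧ DegLeThree G c ∧ ¬ DegLeThree G b := by
    intro x hx
    obtain ⟨a, b, c, hab, hac, hbc, hN⟩ := h.exists_neighbors_of_degLeThree hc4 hx
    have t1 := inTriangle x a b c hab hac hbc hN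
    have t2 := inTriangle x b a c hab.symm hbc hac (fun w => by rw [hN]; tauto)
    have t3 := inTriangle x c a b hac.symm hbc.symm hab (fun w => by rw [hN]; tauto)
    rw [G.adj_comm b a] at t2
    rw [G.adj_comm c a, G.adj_comm c b] at t3
    have : (G.Adj a b ∧ G.Adj b c) ∨ (G.Adj b a ∧ G.Adj a c) ∨ (G.Adj a c ∧ G.Adj c b) := by
      rw [G.adj_comm b a, G.adj_comm c b]
      tauto
    rcases this with ⟨h1, h2⟩ | ⟨h1, h2⟩ | ⟨h1, h2⟩
    · exact ⟨a, b, c, hab, hac, hbc, fun w => by rw [hN]; tauto, h1, h2,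
        path x a b c hab hac hbc hN h1 h2⟩
    · exact ⟨b, a, c, hab.symm, hbc, hac, fun w => by rw [hN], h1, h2,
        path x b a c hab.symm hbc hac (fun w => by rw [hN]; tauto) h1 h2⟩
    · exact ⟨a, c, b, hac, hab, hbc.symm, fun w => by rw [hN]; tauto, h1, h2,
        path x a c b hac hab hbc.symm (fun w => by rw [hN]; tauto) h1 h2⟩
  obtain ⟨x, hx⟩ : ∃ x, DegLeThree G x := by
    have : Nonempty V := (Nat.card_pos_iff.1 (by omega)).1
    obtain ⟨v⟩ := this
    obtain ⟨w, hw, -⟩ := h.exists_adj_ne hc4 v v v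
    rcases edge v w hw with h1 | h1
    exacts [⟨_, h1⟩, ⟨_, h1⟩]
  obtain ⟨a, b, c, hab, hac, hbc, hN, hadj, hadj', ha, hc', hb⟩ := hub x hx
  have rim : ∀ v, G.Adj v b → DegLeThree G v → ∃ p q, p ≠ q ∧ p ≠ b ∧ q ≠ b ∧
      (∀ w, G.Adj v w ↔ w = b ∨ w = p ∨ w = q) ∧ G.Adj p b ∧ G.Adj q b ∧
      DegLeThree G p ∧ DegLeThree G q := by
    intro v hvb hv
    obtain ⟨p, b', q, h1, h2, h3, h4, h5, h6, h7, h8, h9⟩ := hub v hv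
    obtain rfl : b = b' := by
      rcases (h4 b).1 hvb with rfl | rfl | rfl <;> tauto
    exact ⟨p, q, h2, h1, h3.symm, h4, h5, h6.symm, h7, h8⟩
  have hxb : G.Adj x b := by simp [hN]
  have all : ∀ v, v ≠ b → G.Adj v b ∧ DegLeThree G v := by
    intro v hvb
    by_contra hv
    have := h.eq_or_eq b b v (fun v => G.Adj v b ∧ DegLeThree G v) hv hvb hvb (by
      rintro s t ⟨hs, hs'⟩ - - hst
      obtain ⟨p, q, -, -, -, h4, h5, h6, h7, h8⟩ := rim s hs hs'
      rcases (h4 t).1 hst with rfl | rfl | rfl <;> tauto) x ⟨hxb, hx⟩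
    have := hxb.ne
    tauto
  refine ⟨b, fun v hv => ?_⟩
  obtain ⟨p, q, h1, h2, h3, h4, -⟩ := rim v (all v hv).1 (all v hv).2
  exact ⟨p, q, h1, h2, h3, h4⟩

end NoTwoCut

lemma wheelGraph_adj_none_some {r : ℕ} (i : Fin r) : (wheelGraph r).Adj none (some i) := by
  simp [wheelGraph]

lemma wheelGraph_adj_some_some {r : ℕ} (i j : Fin r) : (wheelGraph r).Adj (some i) (some j) ↔
    i ≠ j ∧ ((j : ℕ) = (i + 1) % r ∨ (i : ℕ) = (j + 1) % r) := by
  simp [wheelGraph]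

/-- A walk that never turns back around the rim of a wheel. -/
lemma IsHub.exists_seq {V : Type} {G : SimpleGraph V} {b v₀ : V} (hb : IsHub G b) (hv₀ : v₀ ≠ b) :
    ∃ f : ℕ → V, (∀ n, f n ≠ b) ∧ (∀ n, G.Adj (f n) (f (n + 1))) ∧ (∀ n, f (n + 2) ≠ f n) ∧
      ∀ n w, G.Adj (f (n + 1)) w → w = b ∨ w = f n ∨ w = f (n + 2) := by
  have step : ∀ d : {d : V × V // G.Adj d.1 d.2 ∧ d.1 ≠ b ∧ d.2 ≠ b},
      ∃ d' : {d : V × V // G.Adj d.1 d.2 ∧ d.1 ≠ b ∧ d.2 ≠ b}, d'.1.1 = d.1.2 ∧ d'.1.2 ≠ d.1.1 ∧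
        ∀ w, G.Adj d.1.2 w → w = b ∨ w = d.1.1 ∨ w = d'.1.2 := by
    rintro ⟨⟨u, v⟩, huv, hu, hv⟩
    obtain ⟨p, q, hpq, hp, hq, hN⟩ := hb v hv
    rcases (hN u).1 huv.symm with rfl | rfl | rfl
    · exact (hu rfl).elim
    · exact ⟨⟨(v, q), by simp [hN], hv, hq⟩, rfl, hpq.symm, fun w => (hN w).1⟩
    · exact ⟨⟨(v, p), by simp [hN], hv, hp⟩, rfl, hpq, fun w hw => by
        have := (hN w).1 hw
        simp only
        tauto⟩
  choose next h1 h2 h3 using step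
  obtain ⟨p, q, hpq, hp, hq, hN⟩ := hb v₀ hv₀
  let F : ℕ → {d : V × V // G.Adj d.1 d.2 ∧ d.1 ≠ b ∧ d.2 ≠ b} :=
    fun n => next^[n] ⟨(v₀, p), by simp [hN], hv₀, hp⟩
  have hF : ∀ n, F (n + 1) = next (F n) := fun n => Function.iterate_succ_apply' _ _ _
  have hF' : ∀ n, (F (n + 1)).1.1 = (F n).1.2 := fun n => by rw [hF, h1]
  refine ⟨fun n => (F n).1.1, fun n => (F n).2.2.1, fun n => ?_, fun n => ?_, fun n w hw => ?_⟩
  · simp only [hF']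
    exact (F n).2.1
  · simp only [hF' (n + 1), hF n]
    exact h2 _
  · simp only [hF' (n + 1), hF n]
    exact h3 _ w (by simpa only [hF'] using hw)

theorem IsHub.nonempty_iso_wheelGraph {V : Type} [Finite V] {G : SimpleGraph V} {b v₀ : V}
    (h : NoTwoCut G) (hb : IsHub G b) (hv₀ : v₀ ≠ b) :
    ∃ r, 3 ≤ r ∧ Nonempty (G ≃g wheelGraph r) := by
  classical
  obtain ⟨f, hfb, hadj, hturn, hN⟩ := hb.exists_seq hv₀
  have hrep : ∃ j, ∃ i < j, f i = f j := by
    obtain ⟨i, j, hij, hf⟩ := Finite.exists_ne_map_eq_of_infinite f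
    rcases lt_or_gt_of_ne hij with hlt | hlt
    exacts [⟨j, i, hlt, hf⟩, ⟨i, j, hlt, hf.symm⟩]
  obtain ⟨r, ⟨i, hir, hfi⟩, hmin⟩ : ∃ r, (∃ i < r, f i = f r) ∧ ∀ j < r, ¬ ∃ i < j, f i = f j :=
    ⟨Nat.find hrep, Nat.find_spec hrep, fun j hj => Nat.find_min hrep hj⟩
  have inj : ∀ i < r, ∀ j < r, f i = f j → i = j := by
    intro i hi j hj hij
    by_contra hne
    rcases lt_or_gt_of_ne hne with hlt | hlt
    exacts [hmin j hj ⟨i, hlt, hij⟩, hmin i hi ⟨j, hlt, hij.symm⟩]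
  have hr : i + 3 ≤ r := by
    rcases (by omega : r = i + 1 ∨ r = i + 2 ∨ i + 3 ≤ r) with rfl | rfl | hle
    · exact ((hadj i).ne hfi).elim
    · exact (hturn i hfi.symm).elim
    · exact hle
  obtain ⟨m, rfl⟩ : ∃ m, r = m + 1 := ⟨r - 1, by omega⟩
  have hi0 : i = 0 := by
    by_contra hi
    obtain ⟨k, rfl⟩ := Nat.exists_eq_succ_of_ne_zero hi
    rcases hN k (f m) (by rw [hfi]; exact (hadj m).symm) with h1 | h1 | h1
    · exact hfb _ h1
    · have := inj _ (by omega) _ (by omega) h1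
      omega
    · have := inj _ (by omega) _ (by omega) h1
      omega
  subst hi0
  have hN0 : ∀ w, G.Adj (f 0) w → w = b ∨ w = f m ∨ w = f 1 := by
    have hf1 : f 1 = f (m + 2) := by
      rcases hN m (f 1) (by rw [← hfi]; exact hadj 0) with h1 | h1 | h1
      · exact (hfb _ h1).elim
      · have := inj _ (by omega) _ (by omega) h1
        omega
      · exact h1
    intro w hw
    rw [hf1]
    exact hN m w (hfi ▸ hw)
  have hsurj : ∀ v, v ≠ b → ∃ i < m + 1, f i = v := by
    intro v hvb
    by_contra hv
    have := h.eq_or_eq b b v (fun v => ∃ i < m + 1, f i = v) hv hvb hvb (by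
      rintro _ w ⟨i, hi, rfl⟩ - - hw
      rcases Nat.eq_zero_or_pos i with rfl | hi0
      · rcases hN0 w hw with rfl | rfl | rfl
        exacts [Or.inr (Or.inl rfl), Or.inl ⟨m, by omega, rfl⟩, Or.inl ⟨1, by omega, rfl⟩]
      · obtain ⟨k, rfl⟩ := Nat.exists_eq_succ_of_ne_zero hi0.ne'
        rcases hN k w hw with rfl | rfl | rfl
        · exact Or.inr (Or.inl rfl)
        · exact Or.inl ⟨k, by omega, rfl⟩
        · rcases (by omega : k + 2 < m + 1 ∨ k + 2 = m + 1) with hk | hk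
          · exact Or.inl ⟨_, hk, rfl⟩
          · exact Or.inl ⟨0, by omega, by rw [hk, hfi]⟩) (f 0) ⟨0, by omega, rfl⟩
    have := hfb 0
    tauto
  let g : Option (Fin (m + 1)) → V := fun o => o.elim b (fun i => f i)
  have hg : Function.Bijective g := by
    constructor
    · rintro (_ | i) (_ | j) hij
      · rfl
      · exact (hfb _ hij.symm).elim
      · exact (hfb _ hij).elim
      · rw [Fin.ext (inj i i.2 j j.2 hij)]
    · intro v
      by_cases hv : v = b
      · exact ⟨none, hv.symm⟩
      · obtain ⟨i, hi, rfl⟩ := hsurj v hv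
        exact ⟨some ⟨i, hi⟩, rfl⟩
  have hbadj : ∀ n, G.Adj b (f n) := fun n => by
    obtain ⟨p, q, -, -, -, hpq⟩ := hb (f n) (hfb n)
    exact ((hpq b).2 (Or.inl rfl)).symm
  have hsucc : ∀ i j, i < m + 1 → j = (i + 1) % (m + 1) → G.Adj (f i) (f j) := by
    rintro i j hi rfl
    rcases (by omega : i + 1 < m + 1 ∨ i = m) with hi' | rfl
    · rw [Nat.mod_eq_of_lt hi']
      exact hadj i
    · rw [Nat.mod_self, hfi]
      exact hadj i
  refine ⟨m + 1, by omega, ⟨RelIso.symm ⟨Equiv.ofBijective g hg, ?_⟩⟩⟩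
  rintro (_ | i) (_ | j)
  · simp
  · exact iff_of_true (hbadj j) (wheelGraph_adj_none_some j)
  · exact iff_of_true (hbadj i).symm (wheelGraph_adj_none_some i).symm
  · rw [wheelGraph_adj_some_some]
    change G.Adj (f i) (f j) ↔ _
    obtain ⟨i, hi⟩ := i
    obtain ⟨j, hj⟩ := j
    simp only [ne_eq, Fin.mk.injEq]
    constructor
    · intro hij
      refine ⟨fun h => hij.ne (by rw [h]), ?_⟩
      rcases Nat.eq_zero_or_pos i with rfl | hi0
      · rcases hN0 _ hij with h1 | h1 | h1
        · exact (hfb _ h1).elim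
        · right
          rw [inj _ hj _ (by omega) h1, Nat.mod_self]
        · left
          rw [inj _ hj _ (by omega) h1, Nat.mod_eq_of_lt (by omega)]
      · obtain ⟨k, rfl⟩ := Nat.exists_eq_succ_of_ne_zero hi0.ne'
        rcases hN k _ hij with h1 | h1 | h1
        · exact (hfb _ h1).elim
        · right
          rw [inj _ hj _ (by omega) h1, Nat.mod_eq_of_lt hi]
        · left
          rcases (by omega : k + 2 < m + 1 ∨ k + 2 = m + 1) with hk | hk
          · rw [inj _ hj _ hk h1, Nat.mod_eq_of_lt hk]
          · rw [hk, ← hfi] at h1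
            rw [inj _ hj _ (by omega) h1, Nat.succ_eq_add_one, add_assoc, hk, Nat.mod_self]
    · rintro ⟨-, h1 | h1⟩
      · exact hsucc _ _ hi h1
      · exact (hsucc _ _ hj h1).symm

lemma splitGraph_adj_inl_inl {V : Type} {G : SimpleGraph V} {v : V} {A B : Set V}
    (a b : {u : V // u ≠ v}) :
    (splitGraph G v A B).Adj (Sum.inl a) (Sum.inl b) ↔ G.Adj (a : V) b := by
  simp only [splitGraph, fromRel_adj, G.adj_comm b a, or_self, and_iff_right_iff_imp]
  rintro h heq
  rw [Sum.inl.inj heq] at h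
  exact h.ne rfl

lemma splitGraph_adj_inl_inr {V : Type} {G : SimpleGraph V} {v : V} {A B : Set V}
    (a : {u : V // u ≠ v}) (t : Bool) :
    (splitGraph G v A B).Adj (Sum.inl a) (Sum.inr t) ↔ (a : V) ∈ if t then A else B := by
  cases t <;> simp [splitGraph]

lemma splitGraph_adj_inr_inr {V : Type} {G : SimpleGraph V} {v : V} {A B : Set V} (s t : Bool) :
    (splitGraph G v A B).Adj (Sum.inr s) (Sum.inr t) ↔ s ≠ t := by
  simp [splitGraph]

/-- The graph obtained from `G` by contracting the edge `xy` to the vertex `x`. -/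
def contractGraph {V : Type} (G : SimpleGraph V) (x y : V) : SimpleGraph {u : V // u ≠ y} where
  Adj a b := a ≠ b ∧ (G.Adj a b ∨ (a = x ∧ G.Adj y b) ∨ (b = x ∧ G.Adj y a))
  symm := ⟨fun a b h => ⟨h.1.symm, by rw [G.adj_comm]; tauto⟩⟩
  loopless := ⟨fun a h => h.1 rfl⟩

lemma exists_mem_ne_of_two_le_ncard {V : Type} {A : Set V} (h : 2 ≤ A.ncard) (t : V) :
    ∃ q ∈ A, q ≠ t := by
  obtain ⟨a, ha, b, hb, hab⟩ := (Set.one_lt_ncard (Set.finite_of_ncard_pos (by omega))).1 h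
  by_cases hat : a = t
  · exact ⟨b, hb, fun hbt => hab (hat.trans hbt.symm)⟩
  · exact ⟨a, ha, hat⟩

lemma KConnected.noTwoCut {V : Type} {G : SimpleGraph V} (h : KConnected 3 G) : NoTwoCut G := by
  rintro s t L hs ht ⟨u, hu⟩ hcl v
  by_contra! hv
  have huv : u ≠ v := fun huv => hv.1 (huv ▸ hu)
  obtain ⟨P, -, -, hP⟩ := h huv
  have hit : ∀ {u v : V} (p : G.Walk u v), u ∈ L → ¬ (v ∈ L ∨ v = s ∨ v = t) →
      s ∈ p.support ∨ t ∈ p.support := by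
    intro u v p
    induction p with
    | nil => tauto
    | cons hadj p ih =>
      intro hu hv
      rw [Walk.support_cons, List.mem_cons, List.mem_cons]
      rcases hcl _ hu _ hadj with h1 | rfl | rfl
      · have := ih h1 hv
        tauto
      · exact Or.inl (Or.inr p.start_mem_support)
      · exact Or.inr (Or.inr p.start_mem_support)
  classical
  obtain ⟨i, j, hij, heq⟩ := Fintype.exists_ne_map_eq_of_card_lt
    (fun i => decide (s ∈ (P i).support)) (by simp)
  simp only [decide_eq_decide] at heq
  have hi := hit (P i) hu (by tauto)
  have hj := hit (P j) hu (by tauto)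
  have h1 := hP i j hij s
  have h2 := hP i j hij t
  grind

namespace NoTwoCut

lemma mono {V : Type} {G G' : SimpleGraph V} (h : NoTwoCut G) (hle : G ≤ G') : NoTwoCut G' :=
  fun s t L hs ht hne hcl => h s t L hs ht hne fun a ha b hab => hcl a ha b (hle hab)

lemma of_iso {V W : Type} {G : SimpleGraph V} {G' : SimpleGraph W} (h : NoTwoCut G)
    (e : G ≃g G') : NoTwoCut G' := by
  rintro s t L hs ht ⟨a, ha⟩ hcl v
  have := h (e.symm s) (e.symm t) (e ⁻¹' L) (by simpa) (by simpa) ⟨e.symm a, by simpa⟩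
    (fun a ha b hab => by
      have := hcl _ ha _ (e.map_adj_iff.2 hab)
      simpa [RelIso.eq_symm_apply, Equiv.eq_symm_apply, ← e.injective.eq_iff] using this)
    (e.symm v)
  simpa using this

lemma splitGraph {V : Type} {G : SimpleGraph V} (h : NoTwoCut G) {v : V} {A B : Set V}
    (hAB : A ∪ B = G.neighborSet v) (hA : 2 ≤ A.ncard) (hB : 2 ≤ B.ncard) :
    NoTwoCut (splitGraph G v A B) := by
  have hN : ∀ u, G.Adj v u ↔ u ∈ A ∨ u ∈ B := fun u => by
    rw [← Set.mem_union, hAB, mem_neighborSet]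
  have hmem : ∀ (σ : Bool) (t : V), ∃ q, ∃ hq : q ≠ v, q ≠ t ∧
      (_root_.splitGraph G v A B).Adj (Sum.inl ⟨q, hq⟩) (Sum.inr σ) := by
    intro σ t
    simp only [splitGraph_adj_inl_inr]
    cases σ
    · obtain ⟨q, hq, hqt⟩ := exists_mem_ne_of_two_le_ncard hB t
      exact ⟨q, ((hN q).2 (Or.inr hq)).ne', hqt, by simpa⟩
    · obtain ⟨q, hq, hqt⟩ := exists_mem_ne_of_two_le_ncard hA t
      exact ⟨q, ((hN q).2 (Or.inl hq)).ne', hqt, by simpa⟩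
  let π : {u : V // u ≠ v} ⊕ Bool → V := Sum.elim (fun u : {u : V // u ≠ v} => (u : V)) (fun _ => v)
  -- a cut containing one of the two new vertices
  have new : ∀ (σ : Bool) (t) (L : Set ({u : V // u ≠ v} ⊕ Bool)), Sum.inr σ ∉ L → t ∉ L →
      L.Nonempty → (∀ a ∈ L, ∀ b, (_root_.splitGraph G v A B).Adj a b →
        b ∈ L ∨ b = Sum.inr σ ∨ b = t) → ∀ w, w ∈ L ∨ w = Sum.inr σ ∨ w = t := by
    rintro σ t L hσ ht ⟨l, hl⟩ hcl w
    by_contra! hw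
    obtain ⟨hwL, hwσ, hwt⟩ := hw
    have hπ : ∀ q (hq : q ≠ v), q ≠ π t → Sum.inl ⟨q, hq⟩ ≠ t := by
      rintro q hq hqt rfl
      exact hqt rfl
    obtain ⟨u, hu, huL⟩ : ∃ u, ∃ hu : u ≠ v, Sum.inl ⟨u, hu⟩ ∈ L := by
      rcases l with ⟨u, hu⟩ | τ
      · exact ⟨u, hu, hl⟩
      · obtain ⟨q, hq, hqt, hadj⟩ := hmem τ (π t)
        have := hcl _ hl _ hadj.symm
        exact ⟨q, hq, by simpa [hπ q hq hqt] using this⟩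
    have hut : u ≠ π t := by
      rintro rfl
      rcases t with t | t
      · exact ht huL
      · exact hu rfl
    have key : ∀ u', ∀ hu' : u' ≠ v, u' ≠ π t → Sum.inl ⟨u', hu'⟩ ∈ L := by
      by_contra! hcon
      obtain ⟨u', hu', hut', huL'⟩ := hcon
      have := h.eq_or_eq v (π t) u' (fun p => ∃ hp : p ≠ v, Sum.inl ⟨p, hp⟩ ∈ L)
        (by simp [huL']) hu' hut' (by
          rintro a b ⟨ha, haL⟩ - - hab
          by_cases hb : b = v
          · exact Or.inr (Or.inl hb)
          · rcases hcl _ haL (Sum.inl ⟨b, hb⟩) ((splitGraph_adj_inl_inl _ _).2 hab) with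
              h1 | h1 | h1
            · exact Or.inl ⟨hb, h1⟩
            · simp at h1
            · exact Or.inr (Or.inr (by rw [← h1]; rfl))) u ⟨hu, huL⟩
      tauto
    rcases w with ⟨w, hw⟩ | τ
    · refine hwL (key w hw ?_)
      rintro rfl
      rcases t with t | t
      · exact hwt rfl
      · exact hw rfl
    · obtain ⟨q, hq, hqt, hadj⟩ := hmem τ (π t)
      have := hcl _ (key q hq hqt) _ hadj
      tauto
  intro s t L hs ht hne hcl w
  rcases s with s | σ
  · rcases t with t | τ
    · by_contra! hw
      obtain ⟨hwL, hws, hwt⟩ := hw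
      have hinr : ∀ σ τ, Sum.inr σ ∈ L → Sum.inr τ ∈ L := by
        intro σ τ hσ
        by_cases hστ : σ = τ
        · rwa [← hστ]
        · simpa using hcl _ hσ _ ((splitGraph_adj_inr_inr σ τ).2 hστ)
      obtain ⟨l, hl⟩ := hne
      have := h.eq_or_eq s t (π w) (fun p => ∃ z ∈ L, π z = p) (by
          rintro ⟨z, hz, hzw⟩
          rcases z with ⟨z, hz'⟩ | σ <;> rcases w with ⟨w, hw'⟩ | τ
          · simp only [π, Sum.elim_inl] at hzw
            subst hzw
            exact hwL hz
          · exact hz' hzw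
          · exact hw' hzw.symm
          · exact hwL (hinr _ _ hz)) (by
          rintro hws'
          rcases w with w | w
          · exact hws (congrArg _ (Subtype.ext hws'))
          · exact s.2 hws'.symm) (by
          rintro hws'
          rcases w with w | w
          · exact hwt (congrArg _ (Subtype.ext hws'))
          · exact t.2 hws'.symm) (by
          rintro a b ⟨z, hz, rfl⟩ - - hzb
          obtain ⟨z', z'', hz'', hadj, rfl⟩ : ∃ z', ∃ z'' ∈ L,
              (_root_.splitGraph G v A B).Adj z'' z' ∧ π z' = b := by
            by_cases hb : b = v
            · subst hb
              rcases z with ⟨z, hzv⟩ | σ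
              · rcases (hN z).1 hzb.symm with h1 | h1
                · exact ⟨Sum.inr true, _, hz, (splitGraph_adj_inl_inr _ _).2 (by simpa), rfl⟩
                · exact ⟨Sum.inr false, _, hz, (splitGraph_adj_inl_inr _ _).2 (by simpa), rfl⟩
              · exact (hzb.ne rfl).elim
            · rcases z with ⟨z, hzv⟩ | σ
              · exact ⟨Sum.inl ⟨b, hb⟩, _, hz, (splitGraph_adj_inl_inl _ _).2 hzb, rfl⟩
              · rcases (hN b).1 hzb with h1 | h1
                · exact ⟨Sum.inl ⟨b, hb⟩, _, hinr σ true hz,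
                    ((splitGraph_adj_inl_inr _ _).2 (by simpa)).symm, rfl⟩
                · exact ⟨Sum.inl ⟨b, hb⟩, _, hinr σ false hz,
                    ((splitGraph_adj_inl_inr _ _).2 (by simpa)).symm, rfl⟩
          rcases hcl _ hz'' _ hadj with h1 | rfl | rfl
          · exact Or.inl ⟨_, h1, rfl⟩
          · exact Or.inr (Or.inl rfl)
          · exact Or.inr (Or.inr rfl)) (π l) ⟨l, hl, rfl⟩
      rcases l with l | σ
      · rcases this with h1 | h1
        · exact hs (by rwa [← Subtype.ext h1])
        · exact ht (by rwa [← Subtype.ext h1])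
      · rcases this with h1 | h1
        exacts [s.2 h1.symm, t.2 h1.symm]
    · have := new τ (Sum.inl s) L ht hs hne (fun a ha b hab => by
        have := hcl a ha b hab
        tauto) w
      tauto
  · exact new σ t L hs ht hne hcl w

end NoTwoCut

lemma wheelGraph_noTwoCut {r : ℕ} (hr : 3 ≤ r) : NoTwoCut (wheelGraph r) := by
  rintro s t L hs ht ⟨l, hl⟩ hcl v
  by_contra! hv
  obtain ⟨hvL, hvs, hvt⟩ := hv
  have hub : s = none ∨ t = none := by
    by_contra! h
    have h0 : none ∈ L := by
      rcases l with _ | l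
      · exact hl
      · have := hcl _ hl _ (wheelGraph_adj_none_some l).symm
        tauto
    rcases v with _ | v
    · exact hvL h0
    · have := hcl _ h0 _ (wheelGraph_adj_none_some v)
      tauto
  have hub' : none ∉ L := by
    rcases hub with rfl | rfl <;> assumption
  obtain ⟨l, rfl⟩ := Option.ne_none_iff_exists'.1 (fun h : l = none => hub' (h ▸ hl))
  obtain ⟨w, rfl⟩ := Option.ne_none_iff_exists'.1
    (fun h : v = none => hub.elim (fun h1 => hvs (h.trans h1.symm)) fun h1 => hvt (h.trans h1.symm))
  -- the rim with one vertex `j` removed is a path, which the cut does not separate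
  obtain ⟨j, hjl, hjw, hrim⟩ : ∃ j : Fin r, l ≠ j ∧ w ≠ j ∧ ∀ a, some a ∈ L → ∀ b,
      (wheelGraph r).Adj (some a) (some b) → b = j ∨ some b ∈ L := by
    obtain ⟨j, hj⟩ : ∃ j, ∀ x, some x = s ∨ some x = t → x = j := by
      rcases hub with rfl | rfl
      · rcases t with _ | t
        · exact ⟨w, by simp⟩
        · exact ⟨t, by simp⟩
      · rcases s with _ | s
        · exact ⟨w, by simp⟩
        · exact ⟨s, by simp⟩
    by_cases hst : some j = s ∨ some j = t
    · refine ⟨j, ?_, ?_, fun a ha b hab => ?_⟩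
      · rintro rfl
        grind
      · rintro rfl
        grind
      · have := hcl _ ha _ hab
        grind
    · obtain ⟨j', hj'⟩ : ∃ j', j' ∉ ({l, w} : Finset (Fin r)) := by
        by_contra! h
        have h1 := Finset.card_le_card (fun x _ => h x : Finset.univ ⊆ ({l, w} : Finset (Fin r)))
        have h2 := Finset.card_le_two (a := l) (b := w)
        simp only [Finset.card_univ, Fintype.card_fin] at h1
        omega
      simp only [Finset.mem_insert, Finset.mem_singleton, not_or] at hj'
      refine ⟨j', Ne.symm hj'.1, Ne.symm hj'.2, fun a ha b hab => ?_⟩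
      have := hcl _ ha _ hab
      grind
  let f : ℕ → Fin r := fun k => ⟨(j + k) % r, Nat.mod_lt _ (by omega)⟩
  have hmod : ∀ k < r, (j + k) % r = if j + k < r then j + k else j + k - r := by
    intro k hk
    split_ifs with h
    · exact Nat.mod_eq_of_lt h
    · rw [Nat.mod_eq_sub_mod (by omega), Nat.mod_eq_of_lt (by omega)]
  have hfj : ∀ k < r, 0 < k → f k ≠ j := by
    intro k hk hk0 h
    have := hmod k hk
    have := congrArg Fin.val h
    simp only [f] at this
    split_ifs at * <;> omega
  have hf : ∀ i, i ≠ j → ∃ k < r, 0 < k ∧ f k = i := by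
    intro i hi
    have hi' := Fin.val_ne_of_ne hi
    refine ⟨if (j : ℕ) < i then i - j else i + r - j, ?_, ?_, Fin.ext ?_⟩
    · split_ifs <;> omega
    · split_ifs <;> omega
    · simp only [f]
      rw [hmod _ (by split_ifs <;> omega)]
      split_ifs <;> omega
  have step : ∀ k, 0 < k → k + 1 < r → (some (f k) ∈ L ↔ some (f (k + 1)) ∈ L) := by
    intro k hk hkr
    have hadj : (wheelGraph r).Adj (some (f k)) (some (f (k + 1))) := by
      rw [wheelGraph_adj_some_some]
      refine ⟨fun h => ?_, Or.inl ?_⟩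
      · have := hmod k (by omega)
        have := hmod (k + 1) hkr
        have := congrArg Fin.val h
        simp only [f] at this
        split_ifs at * <;> omega
      · simp [f, add_assoc]
    exact ⟨fun h => (hrim _ h _ hadj).resolve_left (hfj _ hkr (by omega)),
      fun h => (hrim _ h _ hadj.symm).resolve_left (hfj _ (by omega) hk)⟩
  have all : ∀ k, k + 1 < r → (some (f (k + 1)) ∈ L ↔ some (f 1) ∈ L) := by
    intro k
    induction k with
    | zero => simp
    | succ k ih => exact fun hk => (step (k + 1) (by omega) hk).symm.trans (ih (by omega))
  have all' : ∀ i, i ≠ j → (some i ∈ L ↔ some (f 1) ∈ L) := by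
    intro i hi
    obtain ⟨k, hk, hk0, rfl⟩ := hf i hi
    obtain ⟨k, rfl⟩ := Nat.exists_eq_succ_of_ne_zero hk0.ne'
    exact all k hk
  exact hvL ((all' w hjw).2 ((all' l hjl).1 hl))

lemma natCard_subtype_ne {V : Type} [Finite V] (v : V) :
    Nat.card {u : V // u ≠ v} + 1 = Nat.card V := by
  have := Set.ncard_add_ncard_compl {v}
  rwa [Set.ncard_singleton, add_comm] at this

lemma natCard_subtype_ne_sum_bool {V : Type} [Finite V] (v : V) :
    Nat.card ({u : V // u ≠ v} ⊕ Bool) = Nat.card V + 1 := by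
  rw [Nat.card_sum, ← natCard_subtype_ne v]
  simp

lemma isSplittingOf_contractGraph {V : Type} [Finite V] {G : SimpleGraph V} (h : NoTwoCut G)
    (hc : 4 ≤ Nat.card V) {x y : V} (hxy : G.Adj x y) (hno : ¬ ∃ w, G.Adj x w ∧ G.Adj y w) :
    IsSplittingOf G (contractGraph G x y) := by
  have two : ∀ a b (C : Set {u : V // u ≠ y}),
      (∀ u : {u : V // u ≠ y}, G.Adj a u → (u : V) ≠ b → u ∈ C) → (a = y ∨ b = y) →
      2 ≤ C.ncard := by
    intro a b C hC hab
    obtain ⟨p, hp, hpb, -⟩ := h.exists_adj_ne hc a b b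
    obtain ⟨q, hq, hqb, hqp⟩ := h.exists_adj_ne hc a b p
    have hy : ∀ z, G.Adj a z → z ≠ b → z ≠ y := by
      rintro z hz hzb rfl
      exact hab.elim hz.ne hzb.symm
    exact (Set.one_lt_ncard (Set.toFinite C)).2 ⟨⟨p, hy p hp hpb⟩, hC _ hp hpb, ⟨q, hy q hq hqb⟩,
      hC _ hq hqb, fun h => hqp (congrArg Subtype.val h).symm⟩
  refine ⟨⟨x, hxy.ne⟩, {u | G.Adj x u}, {u | G.Adj y u ∧ (u : V) ≠ x}, ?_, ?_,
    two x y _ (fun u hu _ => hu) (Or.inr rfl), two y x _ (fun u hu h => ⟨hu, h⟩) (Or.inl rfl), ?_⟩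
  · ext ⟨u, hu⟩
    have := G.loopless.irrefl x
    simp only [contractGraph, Set.mem_union, mem_neighborSet, Set.mem_ofPred_eq, ne_eq,
      Subtype.ext_iff]
    grind
  · rw [Set.disjoint_left]
    rintro u h1 ⟨h2, -⟩
    exact hno ⟨u, h1, h2⟩
  · let g : {u : {u : V // u ≠ y} // u ≠ ⟨x, hxy.ne⟩} ⊕ Bool → V :=
      Sum.elim (fun u : {u : {u : V // u ≠ y} // u ≠ ⟨x, hxy.ne⟩} => (u.1 : V))
        (fun σ => if σ then x else y)
    have hne := hxy.ne
    have hg : Function.Bijective g := by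
      constructor
      · rintro (⟨⟨a, ha⟩, ha'⟩ | σ) (⟨⟨b, hb⟩, hb'⟩ | τ) h <;>
          simp only [g, Sum.elim_inl, Sum.elim_inr] at h
        · grind
        · cases τ <;> grind
        · cases σ <;> grind
        · cases σ <;> cases τ <;> grind
      · intro v
        by_cases hvx : v = x
        · exact ⟨Sum.inr true, by simp [g, hvx]⟩
        by_cases hvy : v = y
        · exact ⟨Sum.inr false, by simp [g, hvy]⟩
        · exact ⟨Sum.inl ⟨⟨v, hvy⟩, by simpa [Subtype.ext_iff]⟩, rfl⟩
    refine ⟨RelIso.symm ⟨Equiv.ofBijective g hg, ?_⟩⟩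
    have hsymm := fun a b => G.adj_comm a b
    rintro (⟨⟨a, ha⟩, ha'⟩ | σ) (⟨⟨b, hb⟩, hb'⟩ | τ) <;>
      simp only [Equiv.ofBijective_apply, g, Sum.elim_inl, Sum.elim_inr]
    · rw [splitGraph_adj_inl_inl]
      simp only [contractGraph, ne_eq, Subtype.ext_iff] at *
      have := G.loopless.irrefl a
      grind
    · rw [splitGraph_adj_inl_inr]
      cases τ <;> simp [G.adj_comm a]
      grind
    · rw [SimpleGraph.adj_comm (splitGraph _ _ _ _), splitGraph_adj_inl_inr]
      cases σ <;> simp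
      grind
    · rw [splitGraph_adj_inr_inr]
      cases σ <;> cases τ <;> simp [hxy, hxy.symm]

lemma NoTwoCut.contractGraph {V : Type} {G : SimpleGraph V} (h : NoTwoCut G)
    {x y : V} (hxy : G.Adj x y) (hcut : ¬ InThreeCut G x y) : NoTwoCut (contractGraph G x y) := by
  have hne := hxy.ne
  have hcl' : ∀ {s t : {u : V // u ≠ y}} {L : Set {u : V // u ≠ y}},
      (∀ a ∈ L, ∀ b, (_root_.contractGraph G x y).Adj a b → b ∈ L ∨ b = s ∨ b = t) →
      ∀ a ∈ L, ∀ b (hb : b ≠ y), G.Adj a b → ⟨b, hb⟩ ∈ L ∨ b = s ∨ b = t := by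
    intro s t L hcl a ha b hb hab
    have := hcl a ha ⟨b, hb⟩ ⟨fun h => hab.ne (congrArg Subtype.val h), Or.inl hab⟩
    simpa only [Subtype.ext_iff] using this
  have main : ∀ (t : {u : V // u ≠ y}) (L : Set {u : V // u ≠ y}), ⟨x, hne⟩ ∉ L → t ∉ L →
      L.Nonempty → (∀ a ∈ L, ∀ b, (_root_.contractGraph G x y).Adj a b →
        b ∈ L ∨ b = ⟨x, hne⟩ ∨ b = t) → ∀ w, w ∈ L ∨ w = ⟨x, hne⟩ ∨ w = t := by
    rintro t L hx ht ⟨l, hl⟩ hcl w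
    by_contra! hw
    refine hcut ⟨t, l, w, Subtype.val '' L, ?_, ?_, ?_, ⟨l, hl, rfl⟩, ?_, ?_, w.2, ?_, ?_⟩
    · simpa using fun _ => hx
    · simp
    · simpa [t.2] using ht
    · simpa [w.2] using hw.1
    · exact fun h => hw.2.1 (Subtype.ext h)
    · exact fun h => hw.2.2 (Subtype.ext h)
    · rintro _ ⟨a, ha, rfl⟩ q haq
      by_cases hq : q = y
      · tauto
      · rcases hcl' hcl a ha q hq haq with h1 | h1 | h1
        · exact Or.inl ⟨_, h1, rfl⟩
        · exact Or.inr (Or.inl h1)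
        · tauto
  intro s t L hs ht hL hcl w
  by_cases hsx : s = ⟨x, hne⟩
  · subst hsx
    exact main t L hs ht hL hcl w
  by_cases htx : t = ⟨x, hne⟩
  · subst htx
    have := main s L ht hs hL (fun a ha b hab => by have := hcl a ha b hab; tauto) w
    tauto
  by_contra! hw
  obtain ⟨l, hl⟩ := hL
  have hw' : w.1 ≠ s ∧ w.1 ≠ t := ⟨fun h => hw.2.1 (Subtype.ext h), fun h => hw.2.2 (Subtype.ext h)⟩
  have := h.eq_or_eq s t w (fun p => (∃ hp : p ≠ y, ⟨p, hp⟩ ∈ L) ∨ p = y ∧ ⟨x, hne⟩ ∈ L)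
    (by
      rintro (⟨_, h1⟩ | h1)
      exacts [hw.1 h1, w.2 h1.1]) hw'.1 hw'.2 (by
      rintro a b (⟨ha, haL⟩ | ⟨rfl, hxL⟩) - - hab
      · by_cases hb : b = y
        · subst hb
          by_cases hax : a = x
          · subst hax
            exact Or.inl (Or.inr ⟨rfl, haL⟩)
          · have := hcl _ haL ⟨x, hne⟩ ⟨by simpa, Or.inr (Or.inr ⟨rfl, hab.symm⟩)⟩
            tauto
        · have := hcl' hcl _ haL b hb hab
          tauto
      · by_cases hbx : b = x
        · subst hbx
          exact Or.inl (Or.inl ⟨_, hxL⟩)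
        · have := hcl _ hxL ⟨b, hab.ne'⟩ ⟨by simpa using Ne.symm hbx, Or.inr (Or.inl ⟨rfl, hab⟩)⟩
          rcases this with h1 | h1 | h1
          · exact Or.inl (Or.inl ⟨_, h1⟩)
          · exact Or.inr (Or.inl (congrArg Subtype.val h1))
          · exact Or.inr (Or.inr (congrArg Subtype.val h1))) l (Or.inl ⟨l.2, hl⟩)
  rcases this with h1 | h1
  · exact hs (by rwa [← Subtype.ext h1])
  · exact ht (by rwa [← Subtype.ext h1])

/-- `T` separates `A` from `B` in `G`, with `L` containing the part of `A` outside `T`. -/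
structure Separates {V : Type} (G : SimpleGraph V) (A B T L : Set V) : Prop where
  subset : A ⊆ L ∪ T
  notMem : ∀ x ∈ L, x ∉ T ∧ x ∉ B
  closed : ∀ x ∈ L, ∀ y, G.Adj x y → y ∈ L ∨ y ∈ T

/-- There are `k` pairwise disjoint walks from `A` to `B` in `G`. -/
def Linked {V : Type} (G : SimpleGraph V) (A B : Set V) (k : ℕ) : Prop :=
  ∃ (a b : Fin k → V) (p : ∀ i, G.Walk (a i) (b i)), (∀ i, a i ∈ A) ∧ (∀ i, b i ∈ B) ∧
    ∀ i j, i ≠ j → ∀ z ∈ (p i).support, z ∉ (p j).support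

lemma Linked.mono {V : Type} {G G' : SimpleGraph V} {A B : Set V} {k : ℕ} (h : Linked G A B k)
    (hle : G ≤ G') : Linked G' A B k := by
  obtain ⟨a, b, p, ha, hb, hp⟩ := h
  exact ⟨a, b, fun i => (p i).mapLe hle, ha, hb, fun i j hij z => by simpa using hp i j hij z⟩

lemma linked_of_le_ncard_inter {V : Type} [Finite V] {G : SimpleGraph V} {A B : Set V} {k : ℕ}
    (h : k ≤ (A ∩ B).ncard) : Linked G A B k := by
  have e := (Finite.equivFin (A ∩ B : Set V)).symm
  let f : Fin k → (A ∩ B : Set V) := fun i => e (Fin.castLE h i)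
  have hf : Function.Injective f := e.injective.comp (Fin.castLE_injective h)
  refine ⟨fun i => f i, fun i => f i, fun i => Walk.nil, fun i => (f i).2.1, fun i => (f i).2.2,
    fun i j hij z hz hz' => hij (hf (Subtype.ext ?_))⟩
  simp only [Walk.support_nil, List.mem_singleton] at hz hz'
  exact hz.symm.trans hz'

lemma SimpleGraph.Walk.support_subset_of_adj {V : Type} {G : SimpleGraph V} {S : Set V} {u v : V}
    (p : G.Walk u v) (hS : ∀ a b, G.Adj a b → a ∈ S) (hv : v ∈ S) : ∀ z ∈ p.support, z ∈ S := by
  induction p with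
  | nil => simpa using hv
  | cons h p ih =>
    simp only [Walk.support_cons, List.mem_cons, forall_eq_or_imp]
    exact ⟨hS _ _ h, ih hv⟩

lemma exists_eq_of_injective_of_ncard_eq {V : Type} [Finite V] {S : Set V} {k : ℕ} {f : Fin k → V}
    (hf : Function.Injective f) (hS : ∀ i, f i ∈ S) (hk : S.ncard = k) : ∀ z ∈ S, ∃ i, f i = z := by
  have h : Set.range f = S := Set.eq_of_subset_of_ncard_le (Set.range_subset_iff.2 hS)
    (by rw [hk, Set.ncard_range_of_injective hf]; simp)
  intro z hz
  rwa [← h] at hz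

/-- Gluing two linkages along a separation crossed by the single edge `xy`. -/
lemma Linked.glue {V : Type} [Finite V] {G G₁ G₂ : SimpleGraph V} {A B T L : Set V} {x y : V}
    {k : ℕ} (hle₁ : G₁ ≤ G) (hle₂ : G₂ ≤ G) (hG₁ : ∀ a b, G₁.Adj a b → a ∈ L ∪ T)
    (hG₂ : ∀ a b, G₂.Adj a b → a ∉ L) (hTL : ∀ z ∈ L, z ∉ T) (hxy : G.Adj x y) (hx : x ∈ L)
    (hy : y ∉ L) (hyT : y ∉ T) (hT : T.ncard + 1 = k) (h₁ : Linked G₁ A (insert x T) k)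
    (h₂ : Linked G₂ (insert y T) B k) : Linked G A B k := by
  obtain ⟨a, b, p, ha, hb, hp⟩ := h₁
  obtain ⟨c, d, q, hc, hd, hq⟩ := h₂
  have hbi : Function.Injective b := fun i j hij => by
    by_contra hne
    exact hp i j hne (b i) (p i).end_mem_support (by rw [hij]; exact (p j).end_mem_support)
  have hci : Function.Injective c := fun i j hij => by
    by_contra hne
    exact hq i j hne (c i) (q i).start_mem_support (by rw [hij]; exact (q j).start_mem_support)
  have hbs := exists_eq_of_injective_of_ncard_eq hbi hb
    (by rw [Set.ncard_insert_of_notMem (hTL x hx), hT])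
  have hcs := exists_eq_of_injective_of_ncard_eq hci hc
    (by rw [Set.ncard_insert_of_notMem hyT, hT])
  have hpS : ∀ i, ∀ z ∈ (p i).support, z ∈ L ∪ T := fun i =>
    (p i).support_subset_of_adj hG₁ (by
      rcases hb i with h | h
      · exact Or.inl (h ▸ hx)
      · exact Or.inr h)
  have hqS : ∀ i, ∀ z ∈ (q i).support, z ∈ Lᶜ := fun i z hz =>
    (q i).reverse.support_subset_of_adj hG₂ (by
      rcases hc i with h | h
      · exact h ▸ hy
      · exact fun h' => hTL _ h' h) z (by simpa using hz)
  have hσ : ∀ i, ∃ j, (b i = x ∧ c j = y) ∨ (b i ∈ T ∧ c j = b i) := by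
    intro i
    rcases hb i with h | h
    · obtain ⟨j, hj⟩ := hcs y (Set.mem_insert _ _)
      exact ⟨j, Or.inl ⟨h, hj⟩⟩
    · obtain ⟨j, hj⟩ := hcs (b i) (Set.mem_insert_of_mem _ h)
      exact ⟨j, Or.inr ⟨h, hj⟩⟩
  choose σ hσ using hσ
  have hσi : Function.Injective σ := fun i j hij => hbi (by grind)
  have hw : ∀ i, ∃ w : G.Walk (a i) (d (σ i)), ∀ z ∈ w.support,
      z ∈ (p i).support ∨ z ∈ (q (σ i)).support := by
    intro i
    rcases hσ i with ⟨h1, h2⟩ | ⟨-, h⟩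
    · refine ⟨((p i).mapLe hle₁).append (Walk.cons (h1 ▸ h2 ▸ hxy) ((q (σ i)).mapLe hle₂)), ?_⟩
      intro z hz
      simp only [Walk.mem_support_append_iff, Walk.support_cons, List.mem_cons,
        Walk.support_mapLe_eq_support] at hz
      rcases hz with hz | rfl | hz
      exacts [Or.inl hz, Or.inl (p i).end_mem_support, Or.inr hz]
    · refine ⟨((p i).mapLe hle₁).append (((q (σ i)).mapLe hle₂).copy h rfl), ?_⟩
      intro z hz
      simpa using hz
  choose w hw using hw
  refine ⟨a, fun i => d (σ i), w, ha, fun i => hd _, ?_⟩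
  have cross : ∀ i j, i ≠ j → ∀ z ∈ (p i).support, z ∉ (q (σ j)).support := by
    intro i j hij z hzi hzj
    have hzT : z ∈ T := (hpS i z hzi).resolve_left (hqS _ z hzj)
    obtain ⟨i', rfl⟩ := hbs z (Set.mem_insert_of_mem _ hzT)
    obtain rfl : i = i' := by
      by_contra hne
      exact hp _ _ hne _ hzi (p i').end_mem_support
    have h := ((hσ i).resolve_left fun h => hTL x hx (h.1 ▸ hzT)).2
    exact hq (σ i) (σ j) (hσi.ne hij) _ (h ▸ (q (σ i)).start_mem_support) hzj
  intro i j hij z hzi hzj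
  rcases hw i z hzi with h1 | h1 <;> rcases hw j z hzj with h2 | h2
  · exact hp i j hij z h1 h2
  · exact cross i j hij z h1 h2
  · exact cross j i hij.symm z h2 h1
  · exact hq _ _ (hσi.ne hij) z h1 h2

/-- Menger's theorem for vertex sets. -/
theorem linked_of_forall_separates {V : Type} [Finite V] {A B : Set V} {k : ℕ}
    {G : SimpleGraph V} (h : ∀ T L, Separates G A B T L → k ≤ T.ncard) : Linked G A B k := by
  induction hn : G.edgeSet.ncard using Nat.strong_induction_on generalizing G A B with
  | _ n ih =>
  have lt : ∀ {G' : SimpleGraph V} {x y : V}, G.Adj x y → G' ≤ G → ¬ G'.Adj x y →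
      G'.edgeSet.ncard < n := fun {G' x y} hxy hle hnot => hn ▸
    Set.ncard_lt_ncard (edgeSet_strict_mono (lt_of_le_not_ge hle fun h' => hnot (h' hxy)))
  by_cases hbot : ∀ x y, ¬ G.Adj x y
  · refine linked_of_le_ncard_inter (h (A ∩ B) (A \ B)
      ⟨?_, ?_, fun x _ y hxy => (hbot x y hxy).elim⟩)
    · intro a ha
      by_cases hb : a ∈ B
      exacts [Or.inr ⟨ha, hb⟩, Or.inl ⟨ha, hb⟩]
    · exact fun x hx => ⟨fun h => hx.2 h.2, hx.2⟩
  push Not at hbot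
  obtain ⟨x, y, hxy⟩ := hbot
  have hdel : ∀ a b, (G.deleteEdges {s(x, y)}).Adj a b ↔
      G.Adj a b ∧ ¬ (a = x ∧ b = y ∨ a = y ∧ b = x) := by simp
  by_cases hG : ∀ T L, Separates (G.deleteEdges {s(x, y)}) A B T L → k ≤ T.ncard
  · exact (ih _ (lt hxy (deleteEdges_le _) (by simp)) hG rfl).mono (deleteEdges_le _)
  push Not at hG
  obtain ⟨T, L, hTL, hTk⟩ := hG
  obtain ⟨x, y, hxy, hx, hy, hyT, hcl⟩ : ∃ x y, G.Adj x y ∧ x ∈ L ∧ y ∉ L ∧ y ∉ T ∧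
      ∀ a ∈ L, ∀ b, G.Adj a b → b ∈ L ∨ b ∈ T ∨ a = x ∧ b = y := by
    by_contra! hcon
    refine absurd (h T L ⟨hTL.subset, hTL.notMem, fun a ha b hab => ?_⟩) (by omega)
    by_contra! hb
    obtain ⟨a', ha', b', hab', h1, h2, h3⟩ := hcon a b hab ha hb.1 hb.2
    have c1 := hTL.closed a ha b
    have c2 := hTL.closed a' ha' b'
    rw [hdel] at c1 c2
    grind
  clear hdel
  have hT : T.ncard + 1 = k := by
    have := h (insert x T) (L \ {x}) ⟨?_, ?_, ?_⟩
    · rw [Set.ncard_insert_of_notMem (hTL.notMem x hx).1] at this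
      omega
    · intro a ha
      have := hTL.subset ha
      grind
    · rintro a ⟨ha, hax⟩
      have := hTL.notMem a ha
      grind
    · rintro a ⟨ha, hax⟩ b hab
      have := hcl a ha b hab
      grind
  let G₁ : SimpleGraph V :=
    ⟨fun a b => G.Adj a b ∧ a ∈ L ∪ T ∧ b ∈ L ∪ T, ⟨fun a b hab => ⟨hab.1.symm, hab.2.2, hab.2.1⟩⟩,
      ⟨fun a ha => ha.1.ne rfl⟩⟩
  let G₂ : SimpleGraph V :=
    ⟨fun a b => G.Adj a b ∧ a ∉ L ∧ b ∉ L, ⟨fun a b hab => ⟨hab.1.symm, hab.2.2, hab.2.1⟩⟩,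
      ⟨fun a ha => ha.1.ne rfl⟩⟩
  have hle₁ : G₁ ≤ G := fun a b hab => hab.1
  have hle₂ : G₂ ≤ G := fun a b hab => hab.1
  refine Linked.glue (G₁ := G₁) (G₂ := G₂) hle₁ hle₂ (fun a b hab => hab.2.1)
    (fun a b hab => hab.2.1) (fun z hz => (hTL.notMem z hz).1) hxy hx hy hyT hT
    (ih _ (lt hxy hle₁ fun h' => h'.2.2.elim hy hyT) (fun T₁ L₁ hTL₁ => ?_) rfl)
    (ih _ (lt hxy hle₂ fun h' => h'.2.1 hx) (fun T₂ L₂ hTL₂ => ?_) rfl)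
  · refine h T₁ (L ∩ L₁) ⟨fun a ha => ?_, fun a ha => ?_, fun a ha b hab => ?_⟩
    · have h1 := hTL.subset ha
      have h2 := hTL₁.subset ha
      have h3 := hTL₁.notMem a
      grind
    · exact ⟨(hTL₁.notMem a ha.2).1, (hTL.notMem a ha.1).2⟩
    · have h1 := hcl a ha.1 b hab
      have h2 := hTL₁.notMem a ha.2
      have h3 := hTL₁.notMem b
      have h4 : b ∈ L ∪ T → b ∈ L₁ ∨ b ∈ T₁ := fun hb => hTL₁.closed a ha.2 b ⟨hab, Or.inl ha.1, hb⟩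
      grind
  · refine h T₂ ((L ∪ L₂) \ T₂) ⟨fun a ha => ?_, fun a ha => ?_, fun a ha b hab => ?_⟩
    · have h1 := hTL.subset ha
      have h2 := @hTL₂.subset a
      grind
    · have h1 := hTL.notMem a
      have h2 := hTL₂.notMem a
      grind
    · have h1 := hcl a
      have h2 := @hTL₂.subset b
      have h3 : a ∈ L₂ → a ∉ L → b ∉ L → b ∈ L₂ ∨ b ∈ T₂ :=
        fun ha ha' hb => hTL₂.closed a ha b ⟨hab, ha', hb⟩
      grind

/-- The graph obtained from `G` by deleting all edges at `u` and at `v`. -/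
def isolate {V : Type} (G : SimpleGraph V) (u v : V) : SimpleGraph V where
  Adj a b := G.Adj a b ∧ (a ≠ u ∧ a ≠ v) ∧ b ≠ u ∧ b ≠ v
  symm := ⟨fun _ _ h => ⟨h.1.symm, h.2.2, h.2.1⟩⟩
  loopless := ⟨fun _ h => h.1.ne rfl⟩

lemma exists_paths_of_linked {V : Type} {G : SimpleGraph V} {u v : V} (huv : u ≠ v) {k : ℕ}
    (h : Linked (isolate G u v) {a | G.Adj u a ∧ a ≠ v} {b | G.Adj v b ∧ b ≠ u} k) :
    ∃ P : Fin k → G.Walk u v, Function.Injective P ∧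
      (∀ i, (P i).IsPath ∧ ∃ z ∈ (P i).support, z ≠ u ∧ z ≠ v) ∧
      ∀ i j, i ≠ j → ∀ x ∈ (P i).support, x ∈ (P j).support → x = u ∨ x = v := by
  classical
  obtain ⟨a, b, p, ha, hb, hp⟩ := h
  have hle : isolate G u v ≤ G := fun a b hab => hab.1
  have hsup : ∀ i, ∀ z ∈ (p i).support, z ∈ {z | z ≠ u ∧ z ≠ v} := fun i =>
    (p i).support_subset_of_adj (fun a b hab => hab.2.1) ⟨(hb i).2, (hb i).1.ne'⟩
  let q : ∀ i, G.Walk (a i) (b i) := fun i => (p i).bypass.mapLe hle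
  have hqp : ∀ i, ∀ z ∈ (q i).support, z ∈ (p i).support := by
    intro i z hz
    rw [Walk.support_mapLe_eq_support] at hz
    exact (p i).support_bypass_subset_support hz
  let P : Fin k → G.Walk u v := fun i => Walk.cons (ha i).1 ((q i).concat (hb i).1.symm)
  have hP : ∀ i z, z ∈ (P i).support ↔ z = u ∨ z ∈ (q i).support ∨ z = v := by
    intro i z
    simp [P, Walk.support_concat]
  have hdisj : ∀ i j, i ≠ j → ∀ x ∈ (P i).support, x ∈ (P j).support → x = u ∨ x = v := by
    intro i j hij x hi hj
    rw [hP] at hi hj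
    have h1 := hp i j hij x
    have h2 := hqp i x
    have h3 := hqp j x
    tauto
  have hint : ∀ i, ∃ z ∈ (P i).support, z ≠ u ∧ z ≠ v := fun i =>
    ⟨a i, (hP _ _).2 (Or.inr (Or.inl (q i).start_mem_support)), (ha i).1.ne', (ha i).2⟩
  refine ⟨P, fun i j hij => ?_, fun i => ⟨?_, hint i⟩, hdisj⟩
  · by_contra hne
    obtain ⟨z, hz, h1, h2⟩ := hint i
    exact (hdisj i j hne z hz (hij ▸ hz)).elim h1 h2
  · have hpath : (q i).IsPath := ((p i).bypass_isPath).mapLe hle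
    rw [Walk.cons_isPath_iff, Walk.concat_isPath_iff, Walk.support_concat]
    refine ⟨⟨hpath, fun h => (hsup i _ (hqp i _ h)).2 rfl⟩, fun h => ?_⟩
    rw [List.mem_append, List.mem_singleton] at h
    exact h.elim (fun h => (hsup i _ (hqp i _ h)).1 rfl) huv

lemma exists_pair_of_ncard_le_two {V : Type} [Finite V] {S : Set V} {w : V} (h : S.ncard ≤ 2) :
    ∃ s t, (∀ z ∈ S, z = s ∨ z = t) ∧ (s ∈ S ∨ s = w) ∧ (t ∈ S ∨ t = w) := by
  obtain h | h | h : S.ncard = 0 ∨ S.ncard = 1 ∨ S.ncard = 2 := by omega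
  · rw [Set.ncard_eq_zero] at h
    exact ⟨w, w, by simp [h], by simp, by simp⟩
  · obtain ⟨s, rfl⟩ := Set.ncard_eq_one.1 h
    exact ⟨s, s, by simp, by simp, by simp⟩
  · obtain ⟨s, t, -, rfl⟩ := Set.ncard_eq_two.1 h
    exact ⟨s, t, by simp, by simp, by simp⟩

theorem NoTwoCut.kConnected {V : Type} [Finite V] {G : SimpleGraph V} (h : NoTwoCut G)
    (hc : 4 ≤ Nat.card V) : KConnected 3 G := by
  intro u v huv
  have hcl : ∀ {T L : Set V},
      Separates (isolate G u v) {a | G.Adj u a ∧ a ≠ v} {b | G.Adj v b ∧ b ≠ u} T L →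
      ∀ a, (a = u ∨ a ∈ L) ∧ a ≠ v → ∀ b, G.Adj a b →
        (b = u ∨ b ∈ L) ∧ b ≠ v ∨ b ∈ T \ {u, v} ∨ a = u ∧ b = v := by
    intro T L hTL a ha b hab
    have h1 := @hTL.subset b
    have h2 := hTL.notMem a
    have h3 : a ∈ L → a ≠ u → a ≠ v → b ≠ u → b ≠ v → b ∈ L ∨ b ∈ T :=
      fun ha h1 h2 h3 h4 => hTL.closed a ha b ⟨hab, ⟨h1, h2⟩, h3, h4⟩
    have h4 := hab.symm
    simp only [Set.mem_ofPred_eq, Set.mem_union, Set.mem_sdiff, Set.mem_insert_iff,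
      Set.mem_singleton_iff] at *
    grind
  obtain ⟨w, -, hwu, hwv⟩ := h.exists_adj_ne hc u u v
  by_cases hadj : G.Adj u v
  · obtain ⟨P, hPi, hP, hPd⟩ := exists_paths_of_linked (G := G) huv (k := 2)
      (linked_of_forall_separates fun T L hTL => by
        by_contra! hT
        have hT' : (T \ {u, v}).ncard ≤ 1 := (Set.ncard_le_ncard Set.sdiff_subset).trans (by omega)
        obtain ⟨s, hs, hsu⟩ : ∃ s, (∀ z ∈ T \ {u, v}, z = s) ∧ s ≠ u := by
          obtain h0 | h1 : (T \ {u, v}).ncard = 0 ∨ (T \ {u, v}).ncard = 1 := by omega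
          · exact ⟨w, by simp [(Set.ncard_eq_zero).1 h0], hwu⟩
          · obtain ⟨s, hs⟩ := Set.ncard_eq_one.1 h1
            have : s ∈ T \ {u, v} := by simp [hs]
            exact ⟨s, by simp [hs], by grind⟩
        obtain ⟨z, hz, hzu, hzs⟩ := h.exists_adj_ne hc v u s
        have := h.eq_or_eq s v z (fun a => (a = u ∨ a ∈ L) ∧ a ≠ v)
          (fun h => (hTL.notMem z (h.1.resolve_left hzu)).2 ⟨hz, hzu⟩) hzs hz.ne'
          (fun a b ha _ _ hab => by
            have h1 := hcl hTL a ha b hab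
            have h2 := hs b
            tauto) u (by simp [huv])
        exact this.elim hsu.symm huv)
    have hmem : ∀ x, x ∈ (Walk.cons hadj Walk.nil : G.Walk u v).support → x = u ∨ x = v := by
      simp
    refine ⟨Fin.cons (Walk.cons hadj Walk.nil) P, ?_, ?_, ?_⟩
    · rw [Fin.cons_injective_iff]
      refine ⟨?_, hPi⟩
      rintro ⟨i, hi⟩
      obtain ⟨z, hz, h1, h2⟩ := (hP i).2
      exact (hmem z (hi ▸ hz)).elim h1 h2
    · refine Fin.cases ?_ fun i => by simpa using (hP i).1
      simpa using huv
    · intro i j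
      cases i using Fin.cases with
      | zero => exact fun _ x hx _ => hmem x hx
      | succ i =>
        cases j using Fin.cases with
        | zero => exact fun _ x _ hx => hmem x hx
        | succ j => exact fun hij x hi hj => hPd i j (fun h => hij (h ▸ rfl)) x hi hj
  · obtain ⟨P, hPi, hP, hPd⟩ := exists_paths_of_linked (G := G) huv (k := 3)
      (linked_of_forall_separates fun T L hTL => by
        by_contra! hT
        obtain ⟨s, t, hst, hs, ht⟩ := exists_pair_of_ncard_le_two (w := w) (S := T \ {u, v})
          ((Set.ncard_le_ncard Set.sdiff_subset).trans (by omega))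
        have := h.eq_or_eq s t v (fun a => (a = u ∨ a ∈ L) ∧ a ≠ v) (by simp) (by grind) (by grind)
          (fun a b ha _ _ hab => by
            have h1 := hcl hTL a ha b hab
            have h2 := hst b
            grind) u (by simp [huv])
        grind)
    exact ⟨P, hPi, fun i => (hP i).1, hPd⟩

lemma WheelStep.noTwoCut {p q : (W : Type) × SimpleGraph W} (hpq : WheelStep p q)
    (h : NoTwoCut p.2 ∧ 4 ≤ Nat.card p.1) : NoTwoCut q.2 ∧ 4 ≤ Nat.card q.1 := by
  obtain ⟨h, hc⟩ := h
  have : Finite p.1 := Nat.finite_of_card_ne_zero (by omega)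
  obtain ⟨v, A, B, hAB, -, hA, hB, ⟨e⟩⟩ | ⟨e, -, ⟨f⟩⟩ := hpq
  · refine ⟨(h.splitGraph hAB hA hB).of_iso e.symm, ?_⟩
    rw [Nat.card_congr e.toEquiv, natCard_subtype_ne_sum_bool]
    omega
  · exact ⟨(h.of_iso f).mono (deleteEdges_le _), by rwa [← Nat.card_congr f.toEquiv]⟩

lemma exists_fin_sequence_of_reflTransGen {α : Type*} {R : α → α → Prop} {a b : α}
    (h : Relation.ReflTransGen R a b) : ∃ (q : ℕ) (f : Fin (q + 1) → α),
      f 0 = a ∧ f (Fin.last q) = b ∧ ∀ i : Fin q, R (f i.castSucc) (f i.succ) := by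
  induction h with
  | refl => exact ⟨0, fun _ => a, rfl, rfl, fun i => i.elim0⟩
  | @tail b c _ hbc ih =>
    obtain ⟨q, f, h0, hq, hf⟩ := ih
    refine ⟨q + 1, Fin.snoc f c, ?_, by simp, fun i => ?_⟩
    · rw [← Fin.castSucc_zero, Fin.snoc_castSucc, h0]
    · induction i using Fin.lastCases with
      | last => simpa [hq] using hbc
      | cast i =>
        rw [← Fin.castSucc_succ, Fin.snoc_castSucc, Fin.snoc_castSucc]
        exact hf i

lemma NoTwoCut.isHub_of_natCard_eq_four {V : Type} [Finite V] {G : SimpleGraph V}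
    (h : NoTwoCut G) (hc : Nat.card V = 4) (b : V) : IsHub G b := by
  classical
  have := Fintype.ofFinite V
  intro v hvb
  obtain ⟨p, hpv, hpb, -⟩ := exists_ne_of_four_le_card hc.ge v b b
  obtain ⟨q, hqv, hqb, hqp⟩ := exists_ne_of_four_le_card hc.ge v b p
  have hall : ∀ w, w = v ∨ w = b ∨ w = p ∨ w = q := by
    by_contra! hw
    obtain ⟨w, h1, h2, h3, h4⟩ := hw
    have h5 := Finset.card_le_univ ({w, v, b, p, q} : Finset V)
    rw [← Nat.card_eq_fintype_card, hc] at h5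
    have h6 : ({w, v, b, p, q} : Finset V).card = 5 := by
      simp [Finset.card_insert_of_notMem, h1, h2, h3, h4, hvb, hpv.symm, hpb.symm, hqv.symm,
        hqb.symm, hqp.symm]
    omega
  refine ⟨p, q, hqp.symm, hpb, hqb, fun w => ⟨fun hw => ?_, ?_⟩⟩
  · have := hall w
    have := hw.ne'
    tauto
  · have key : ∀ s t u, (∀ w, w = v ∨ w = u ∨ w = s ∨ w = t) → G.Adj v u := by
      intro s t u hu
      obtain ⟨w, hw, hws, hwt⟩ := h.exists_adj_ne hc.ge v s t
      obtain rfl : w = u := by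
        have := hu w
        have := hw.ne'
        tauto
      exact hw
    rintro (rfl | rfl | rfl)
    · exact key p q _ hall
    · exact key b q _ fun w => by have := hall w; tauto
    · exact key b p _ fun w => by have := hall w; tauto

theorem NoTwoCut.exists_reflTransGen_wheelStep {V : Type} [Finite V] {G : SimpleGraph V}
    (h : NoTwoCut G) (hc : 4 ≤ Nat.card V) : ∃ p : (W : Type) × SimpleGraph W,
      (∃ r, 3 ≤ r ∧ Nonempty (p.2 ≃g wheelGraph r)) ∧
      Relation.ReflTransGen WheelStep p ⟨V, G⟩ := by
  induction hn : Nat.card V using Nat.strong_induction_on generalizing V with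
  | _ n ihn =>
  induction hm : G.edgeSet.ncard using Nat.strong_induction_on generalizing G with
  | _ m ihm =>
  have wheel : ∀ b, IsHub G b → ∃ p : (W : Type) × SimpleGraph W,
      (∃ r, 3 ≤ r ∧ Nonempty (p.2 ≃g wheelGraph r)) ∧
      Relation.ReflTransGen WheelStep p ⟨V, G⟩ := by
    intro b hb
    obtain ⟨v₀, hv₀, -⟩ := exists_ne_of_four_le_card hc b b b
    exact ⟨⟨V, G⟩, hb.nonempty_iso_wheelGraph h hv₀, .refl⟩
  obtain hc4 | hc5 : Nat.card V = 4 ∨ 5 ≤ Nat.card V := by omega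
  · have : Nonempty V := Nat.card_pos_iff.1 (by omega) |>.1
    exact wheel _ (h.isHub_of_natCard_eq_four hc4 (Classical.arbitrary V))
  by_cases hdel : ∃ x y, G.Adj x y ∧ NoTwoCut (G.deleteEdges {s(x, y)})
  · obtain ⟨x, y, hxy, hdel⟩ := hdel
    obtain ⟨p, hp, hstep⟩ := ihm _ (hm ▸ Set.ncard_lt_ncard (edgeSet_strict_mono
      (lt_of_le_not_ge (deleteEdges_le _) fun h' => by simpa using h' hxy))) hdel rfl
    exact ⟨p, hp, hstep.tail (Or.inr ⟨s(x, y), hxy, ⟨RelIso.refl _⟩⟩)⟩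
  by_cases hcon : ∃ x y, G.Adj x y ∧ ¬ InThreeCut G x y ∧ ¬ ∃ w, G.Adj x w ∧ G.Adj y w
  · obtain ⟨x, y, hxy, hcut, hno⟩ := hcon
    have hcard := natCard_subtype_ne y
    obtain ⟨p, hp, hstep⟩ := ihn _ (by omega) (h.contractGraph hxy hcut) (by omega) rfl
    exact ⟨p, hp, hstep.tail (Or.inl (isSplittingOf_contractGraph h hc hxy hno))⟩
  push Not at hdel hcon
  obtain ⟨b, hb⟩ := h.exists_isHub hc5 hdel fun x y hxy => or_iff_not_imp_left.2 (hcon x y hxy)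
  exact wheel b hb

/-- Tutte's wheel theorem: a graph on at least four vertices is triconnected iff it can be
obtained from a wheel by a sequence of splittings and edge additions. -/
theorem tutte_wheel_theorem {V : Type} [Finite V] (G : SimpleGraph V) :
    (KConnected 3 G ∧ 4 ≤ Nat.card V) ↔
    ∃ (q : ℕ) (Gs : Fin (q + 1) → (W : Type) × SimpleGraph W),
      (∃ r : ℕ, 3 ≤ r ∧ Nonempty ((Gs 0).2 ≃g wheelGraph r)) ∧
      Nonempty ((Gs (Fin.last q)).2 ≃g G) ∧
      ∀ i : Fin q, WheelStep (Gs i.castSucc) (Gs i.succ) := by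
  constructor
  · rintro ⟨hG, hc⟩
    obtain ⟨p, hp, hstep⟩ := hG.noTwoCut.exists_reflTransGen_wheelStep hc
    obtain ⟨q, Gs, h0, hq, hGs⟩ := exists_fin_sequence_of_reflTransGen hstep
    exact ⟨q, Gs, h0 ▸ hp, hq ▸ ⟨RelIso.refl _⟩, hGs⟩
  · rintro ⟨q, Gs, ⟨r, hr, ⟨e⟩⟩, ⟨f⟩, hGs⟩
    have hall : ∀ i, NoTwoCut (Gs i).2 ∧ 4 ≤ Nat.card (Gs i).1 := by
      intro i
      induction i using Fin.induction with
      | zero =>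
        refine ⟨(wheelGraph_noTwoCut hr).of_iso e.symm, ?_⟩
        rw [Nat.card_congr e.toEquiv, Finite.card_option, Nat.card_fin]
        omega
      | succ i ih => exact (hGs i).noTwoCut ih
    obtain ⟨h, hc⟩ := hall (Fin.last q)
    rw [Nat.card_congr f.toEquiv] at hc
    exact ⟨(h.of_iso f).kConnected hc, hc⟩
end
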